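/- Every twin-free subcubic graph G on n vertices without isolated vertices satisfies γ^LD(G) ≤ n/2. -/

import Mathlib

open SimpleGraph

/-- The closed neighbourhood `N[v] = N(v) ∪ {v}` of a vertex. -/
def closedNbhd {V : Type*} (G : SimpleGraph V) (v : V) : Set V :=
  insert v (G.neighborSet v)

/-- The degree of a vertex, as the cardinality of its open neighbourhood. -/
noncomputable def deg {V : Type*} (G : SimpleGraph V) (v : V) : ℕ :=
  (G.neighborSet v).ncard

/-- `S` is a dominating set: every vertex has a member of `S` in its closed neighbourhood. -/
def IsDominating {V : Type*} (G : SimpleGraph V) (S : Set V) : Prop :=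
  ∀ v : V, (closedNbhd G v ∩ S).Nonempty

/-- `S` is a locating-dominating set: it dominates and separates all pairs of
vertices outside `S` by their closed neighbourhoods intersected with `S`. -/
def IsLDSet {V : Type*} (G : SimpleGraph V) (S : Set V) : Prop :=
  IsDominating G S ∧
    ∀ u ∉ S, ∀ v ∉ S, u ≠ v → closedNbhd G u ∩ S ≠ closedNbhd G v ∩ S

/-- The location-domination number `γ^LD(G)`. -/
noncomputable def ldNum {V : Type*} (G : SimpleGraph V) : ℕ :=
  sInf {k : ℕ | ∃ S : Set V, IsLDSet G S ∧ S.ncard = k}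

/-- A graph is subcubic if every vertex has degree at most 3. -/
def Subcubic {V : Type*} (G : SimpleGraph V) : Prop :=
  ∀ v : V, deg G v ≤ 3

/-- `u` and `v` are open twins: distinct vertices with the same open neighbourhood. -/
def OpenTwins {V : Type*} (G : SimpleGraph V) (u v : V) : Prop :=
  u ≠ v ∧ G.neighborSet u = G.neighborSet v

/-- `u` and `v` are closed twins: distinct vertices with the same closed neighbourhood. -/
def ClosedTwins {V : Type*} (G : SimpleGraph V) (u v : V) : Prop :=
  u ≠ v ∧ closedNbhd G u = closedNbhd G v

/-- A graph is twin-free if it has neither open twins nor closed twins. -/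
def TwinFree {V : Type*} (G : SimpleGraph V) : Prop :=
  (¬ ∃ u v : V, OpenTwins G u v) ∧ (¬ ∃ u v : V, ClosedTwins G u v)

section
variable {V : Type*}

/-- Every vertex has at most three neighbours, in a form that is easy to instantiate. -/
def AtMostThree (G : SimpleGraph V) : Prop :=
  ∀ v, ∃ a b d, ∀ w, G.Adj v w → w = a ∨ w = b ∨ w = d

/-- Distinct vertices satisfying this relation are open twins or closed twins. -/
def Twins (G : SimpleGraph V) (u v : V) : Prop :=
  (∀ w, G.Adj u w ↔ G.Adj v w) ∨ (∀ w, (w = u ∨ G.Adj u w) ↔ (w = v ∨ G.Adj v w))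

/-- `u` and `v` have the same colour and the same neighbours of the other colour. -/
def Clash (G : SimpleGraph V) (c : V → Bool) (u v : V) : Prop :=
  c u = c v ∧ ∀ w, c w ≠ c u → (G.Adj u w ↔ G.Adj v w)

/-- Every non-isolated vertex has a neighbour of the other colour, and only twins clash. -/
def Good (G : SimpleGraph V) (c : V → Bool) : Prop :=
  (∀ v w, G.Adj v w → ∃ z, G.Adj v z ∧ c z ≠ c v) ∧
    ∀ u v, u ≠ v → Clash G c u v → Twins G u v

lemma Twins.symm {G : SimpleGraph V} {u v : V} (h : Twins G u v) : Twins G v u := by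
  unfold Twins at *
  grind

lemma Clash.symm {G : SimpleGraph V} {c : V → Bool} {u v : V} (h : Clash G c u v) :
    Clash G c v u := by
  unfold Clash at *
  grind

lemma AtMostThree.nbr_eq {G : SimpleGraph V} (h3 : AtMostThree G) {v a b d : V}
    (ha : G.Adj v a) (hb : G.Adj v b) (hd : G.Adj v d) (hab : a ≠ b) (had : a ≠ d)
    (hbd : b ≠ d) {w : V} (hw : G.Adj v w) : w = a ∨ w = b ∨ w = d := by
  obtain ⟨x, y, z, h⟩ := h3 v
  grind

lemma AtMostThree.exists_third {G : SimpleGraph V} (h3 : AtMostThree G) {v a b : V}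
    (ha : G.Adj v a) (hb : G.Adj v b) (hab : a ≠ b) :
    ∃ d, ∀ w, G.Adj v w → w = a ∨ w = b ∨ w = d := by
  obtain ⟨x, y, z, h⟩ := h3 v
  have := h a ha
  have := h b hb
  by_cases hd : ∃ d, G.Adj v d ∧ d ≠ a ∧ d ≠ b
  · obtain ⟨d, hd⟩ := hd
    exact ⟨d, by grind⟩
  · exact ⟨a, by grind⟩

/-- A good colouring of `G'` extends to `G` when the two graphs agree outside `R`, and the
colouring of `R` serves the outside vertices at least as well as `G'` does. -/
lemma good_of_extend {G G' : SimpleGraph V} {c c' : V → Bool} (R : Set V)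
    (hind : ∀ a b, a ∉ R → b ∉ R → (G'.Adj a b ↔ G.Adj a b))
    (hgood : Good G' c') (hagree : ∀ a, a ∉ R → c a = c' a)
    (hone : ∀ r ∈ R, ∀ a b, a ∉ R → b ∉ R → G.Adj r a → G.Adj r b → a = b)
    (hserve : ∀ w r, w ∉ R → r ∈ R → G'.Adj w r → c' r ≠ c' w →
      ∃ q ∈ R, G.Adj w q ∧ c q ≠ c w)
    (hiso : ∀ w r, w ∉ R → r ∈ R → G.Adj w r →
      (∃ z, G'.Adj w z) ∨ ∃ q ∈ R, G.Adj w q ∧ c q ≠ c w)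
    (htwin : ∀ a b, a ∉ R → b ∉ R → a ≠ b → c' a = c' b → Twins G' a b → Twins G a b ∨
      (∃ q ∈ R, G.Adj a q ∧ c q ≠ c a) ∨ ∃ q ∈ R, G.Adj b q ∧ c q ≠ c b)
    (hdom : ∀ r ∈ R, ∀ w, G.Adj r w → ∃ z, G.Adj r z ∧ c z ≠ c r)
    (hloc : ∀ r ∈ R, ∀ b, b ≠ r → Clash G c r b → Twins G r b) : Good G c := by
  refine ⟨fun v w hvw => ?_, fun u v huv h => ?_⟩
  · by_cases hv : v ∈ R
    · exact hdom v hv w hvw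
    have key : (∃ z, G'.Adj v z) → ∃ z, G.Adj v z ∧ c z ≠ c v := by
      rintro ⟨z, hz⟩
      obtain ⟨z, hz, hc⟩ := hgood.1 v z hz
      by_cases hzR : z ∈ R
      · obtain ⟨q, -, hq⟩ := hserve v z hv hzR hz hc
        exact ⟨q, hq⟩
      · exact ⟨z, (hind v z hv hzR).1 hz, by rw [hagree z hzR, hagree v hv]; exact hc⟩
    by_cases hw : w ∈ R
    · rcases hiso v w hv hw hvw with h | ⟨q, -, hq⟩
      · exact key h
      · exact ⟨q, hq⟩
    · exact key ⟨w, (hind v w hv hw).2 hvw⟩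
  · by_cases hu : u ∈ R
    · exact hloc u hu v huv.symm h
    by_cases hv : v ∈ R
    · exact (hloc v hv u huv h.symm).symm
    have hsu : ¬ ∃ q ∈ R, G.Adj u q ∧ c q ≠ c u := by
      rintro ⟨q, hq, hadj, hc⟩
      exact huv (hone q hq u v hu hv hadj.symm ((h.2 q hc).1 hadj).symm)
    have hsv : ¬ ∃ q ∈ R, G.Adj v q ∧ c q ≠ c v := by
      rintro ⟨q, hq, hadj, hc⟩
      exact huv (hone q hq u v hu hv ((h.symm.2 q hc).1 hadj).symm hadj.symm)
    have hcc : c' u = c' v := by rw [← hagree u hu, ← hagree v hv]; exact h.1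
    have hcl : Clash G' c' u v := by
      refine ⟨hcc, fun w hw => ?_⟩
      by_cases hwR : w ∈ R
      · constructor
        · intro hadj; exact (hsu (hserve u w hu hwR hadj hw)).elim
        · intro hadj; exact (hsv (hserve v w hv hwR hadj (hcc ▸ hw))).elim
      · rw [hind u w hu hwR, hind v w hv hwR]
        exact h.2 w (by rw [hagree w hwR, hagree u hu]; exact hw)
    rcases htwin u v hu hv huv hcc (hgood.2 u v huv hcl) with h | h | h
    · exact h
    · exact (hsu h).elim
    · exact (hsv h).elim

/-- The graph obtained from `G` by isolating the vertices of `S`. -/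
def isolate (G : SimpleGraph V) (S : Set V) : SimpleGraph V where
  Adj a b := G.Adj a b ∧ a ∉ S ∧ b ∉ S
  symm := ⟨fun _ _ h => ⟨h.1.symm, h.2.2, h.2.1⟩⟩
  loopless := ⟨fun a h => G.loopless.irrefl a h.1⟩

lemma isolate_atMostThree {G : SimpleGraph V} (h3 : AtMostThree G) (S : Set V) :
    AtMostThree (isolate G S) := by
  intro v
  obtain ⟨a, b, d, h⟩ := h3 v
  exact ⟨a, b, d, fun w hw => h w hw.1⟩

lemma isolate_support_ssubset {G : SimpleGraph V} {S : Set V} {x y : V} (hx : x ∈ S)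
    (hxy : G.Adj x y) : (isolate G S).support ⊂ G.support := by
  refine ⟨fun v ⟨w, hw⟩ => ⟨w, hw.1⟩, fun h => ?_⟩
  obtain ⟨w, hw⟩ := h ⟨y, hxy⟩
  exact hw.2.1 hx

/-- A leaf `x` and its neighbour `s` can be removed when, among the remaining neighbours of `s`,
at most the vertex `y` acquires new twins. -/
lemma exists_good_of_leaf {G : SimpleGraph V} {c' : V → Bool} {x s y : V}
    (hx : ∀ w, G.Adj x w ↔ w = s) (hsy : G.Adj s y) (hyx : y ≠ x)
    (hgood : Good (isolate G {s, x}) c')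
    (htwin : ∀ w, G.Adj s w → w ≠ x → w ≠ y → (∃ z, z ≠ s ∧ G.Adj w z) ∧
      ∀ b, b ≠ w → b ≠ s → b ≠ x → Twins (isolate G {s, x}) w b → Twins G w b) :
    ∃ c, Good G c := by
  classical
  have hsx : G.Adj x s := (hx s).2 rfl
  have hne : s ≠ x := hsx.ne'
  have hys : y ≠ s := hsy.ne'
  have hxs : G.Adj s x := hsx.symm
  obtain ⟨c, hcs, hcx, hc⟩ : ∃ c : V → Bool, c s = !c' y ∧ c x = c' y ∧
      ∀ a, a ≠ s → a ≠ x → c a = c' a :=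
    ⟨fun a => if a = s then !c' y else if a = x then c' y else c' a, by grind⟩
  have hadj : ∀ a b, (isolate G {s, x}).Adj a b ↔ G.Adj a b ∧ a ≠ s ∧ a ≠ x ∧ b ≠ s ∧ b ≠ x := by
    intro a b
    simp only [isolate, Set.mem_insert_iff, Set.mem_singleton_iff]
    tauto
  have hsymm : ∀ a b, G.Adj a b → G.Adj b a := fun a b h => h.symm
  have hirr : ∀ a, ¬ G.Adj a a := fun a => G.loopless.irrefl a
  refine ⟨c, fun v w hvw => ?_, fun u v huv h => ?_⟩
  · by_cases hvs : v = s
    · subst hvs; exact ⟨x, by grind⟩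
    by_cases hvx : v = x
    · subst hvx; exact ⟨s, by grind⟩
    by_cases hvy : v = y
    · subst hvy; exact ⟨s, by grind⟩
    have : ∃ z, z ≠ s ∧ G.Adj v z := by
      by_cases hws : w = s
      · subst hws
        exact (htwin v hvw.symm hvx hvy).1
      · exact ⟨w, hws, hvw⟩
    obtain ⟨z, hzs, hz⟩ := this
    obtain ⟨z, hz, hcz⟩ := hgood.1 v z (by grind)
    exact ⟨z, by grind⟩
  · have hcx' : ∀ b, b ≠ x → Clash G c x b → Twins G x b := by
      intro b hbx hb
      have h1 : G.Adj b s := (hb.2 s (by grind)).1 hsx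
      have h2 : ∀ w, G.Adj b w → w = s := by
        intro w hw
        by_contra hws
        obtain ⟨z, hz, hcz⟩ := hgood.1 b w (by grind)
        have := hb.1
        have := (hb.2 z (by grind)).2
        grind
      exact Or.inl (by grind)
    have hcs' : ∀ b, b ≠ s → ¬ Clash G c s b := by
      intro b hbs hb
      have := (hb.2 x (by grind)).1 hxs
      grind
    by_cases hux : u = x
    · subst hux; exact hcx' v huv.symm h
    by_cases hvx : v = x
    · subst hvx; exact (hcx' u huv h.symm).symm
    by_cases hus : u = s
    · subst hus; exact (hcs' v huv.symm h).elim
    by_cases hvs : v = s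
    · subst hvs; exact (hcs' u huv h.symm).elim
    have ht : Twins (isolate G {s, x}) u v := by
      refine hgood.2 u v huv ⟨by rw [← hc u hus hux, ← hc v hvs hvx]; exact h.1, fun w hw => ?_⟩
      have := h.2 w
      grind
    have hyv : ∀ v, G.Adj s v ∨ v ≠ y := by grind
    by_cases h1 : G.Adj s u <;> by_cases h2 : G.Adj s v
    · rcases ht with ht | ht
      · refine Or.inl fun w => ?_
        have := ht w
        grind
      · refine Or.inr fun w => ?_
        have := ht w
        grind
    · by_cases huy : u = y
      · subst huy
        have := h.2 s (by grind)
        grind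
      · exact (htwin u h1 hux huy).2 v huv.symm hvs hvx ht
    · by_cases hvy : v = y
      · subst hvy
        have := h.symm.2 s (by grind)
        grind
      · exact ((htwin v h2 hvx hvy).2 u huv hus hux ht.symm).symm
    · rcases ht with ht | ht
      · refine Or.inl fun w => ?_
        have := ht w
        grind
      · refine Or.inr fun w => ?_
        have := ht w
        grind

lemma isolate_adj_singleton {G : SimpleGraph V} {x a b : V} :
    (isolate G {x}).Adj a b ↔ G.Adj a b ∧ a ≠ x ∧ b ≠ x := by
  simp [isolate]

/-- One of two open twins of degree three can be removed. -/
lemma exists_good_of_openTwins {G : SimpleGraph V} {c' : V → Bool} (h3 : AtMostThree G)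
    {t₁ t₂ a b d : V} (ht : t₁ ≠ t₂) (hN : ∀ w, G.Adj t₁ w ↔ G.Adj t₂ w)
    (ha : G.Adj t₁ a) (hb : G.Adj t₁ b) (hd : G.Adj t₁ d) (hab : a ≠ b) (had : a ≠ d)
    (hbd : b ≠ d) (hgood : Good (isolate G {t₂}) c') : ∃ c, Good G c := by
  classical
  have hsymm : ∀ a b, G.Adj a b → G.Adj b a := fun a b h => h.symm
  have hirr : ∀ a, ¬ G.Adj a a := fun a => G.loopless.irrefl a
  have hadj := fun a b => @isolate_adj_singleton V G t₂ a b
  have hnbr : ∀ w, G.Adj t₁ w → w = a ∨ w = b ∨ w = d :=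
    fun w hw => h3.nbr_eq ha hb hd hab had hbd hw
  obtain ⟨c, hct, hc⟩ : ∃ c : V → Bool, c t₂ = c' t₁ ∧ ∀ a, a ≠ t₂ → c a = c' a :=
    ⟨fun a => if a = t₂ then c' t₁ else c' a, by grind⟩
  have hnc : ∀ v, G.Adj t₁ v → ¬ ∀ w, w ≠ t₂ → ((w = t₁ ∨ G.Adj t₁ w) ↔ (w = v ∨ G.Adj v w)) := by
    intro v hv h
    have := h a (by grind)
    have := h b (by grind)
    have := h d (by grind)
    obtain ⟨x, y, z, h4⟩ := h3 v
    have := h4 a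
    have := h4 b
    have := h4 d
    have := h4 t₁ hv.symm
    have := h4 t₂ (by grind)
    grind
  have key : ∀ v, v ≠ t₁ → v ≠ t₂ → Twins (isolate G {t₂}) t₁ v → Twins G t₁ v := by
    intro v hv1 hv2 h
    rcases h with h | h
    · have := h a
      have := h b
      have := h d
      have : ∀ w, G.Adj v w → w = a ∨ w = b ∨ w = d :=
        fun w hw => h3.nbr_eq (by grind) (by grind) (by grind) hab had hbd hw
      exact Or.inl (by grind)
    · have := h v
      exact (hnc v (by grind) (fun w hw => by have := h w; grind)).elim
  have hcl : ∀ u v, u ≠ t₂ → v ≠ t₂ → Clash G c u v → Clash (isolate G {t₂}) c' u v := by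
    intro u v hu hv h
    have := h.1
    refine ⟨by grind, fun w hw => ?_⟩
    have := h.2 w
    grind
  have hlt : ∀ v, v ≠ t₂ → Clash G c t₂ v → Twins G t₂ v := by
    intro v hv h
    by_cases hv1 : v = t₁
    · subst hv1; exact Or.inl fun w => (hN w).symm
    have h' : Clash G c t₁ v := by
      have := h.1
      refine ⟨by grind, fun w hw => ?_⟩
      have := h.2 w
      grind
    rcases key v hv1 hv (hgood.2 _ _ (by grind) (hcl _ _ ht hv h')) with h | h
    · exact Or.inl (by grind)
    · exact (hnc v (by have := h v; grind) (fun w _ => h w)).elim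
  refine ⟨c, fun v w hvw => ?_, fun u v huv h => ?_⟩
  · by_cases hv : v = t₂
    · obtain ⟨z, hz, hcz⟩ := hgood.1 t₁ a (by grind)
      exact ⟨z, by grind⟩
    · have : ∃ z, (isolate G {t₂}).Adj v z := by
        by_cases hw : w = t₂
        · exact ⟨t₁, by grind⟩
        · exact ⟨w, by grind⟩
      obtain ⟨z, hz⟩ := this
      obtain ⟨z, hz, hcz⟩ := hgood.1 v z hz
      exact ⟨z, by grind⟩
  · by_cases hu : u = t₂
    · subst hu; exact hlt v huv.symm h
    by_cases hv : v = t₂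
    · subst hv; exact (hlt u huv h.symm).symm
    have h' := hgood.2 u v huv (hcl u v hu hv h)
    by_cases hu1 : u = t₁
    · subst hu1; exact key v huv.symm hv h'
    by_cases hv1 : v = t₁
    · subst hv1; exact (key u huv hu h'.symm).symm
    rcases h' with h' | h'
    · exact Or.inl fun w => by
        have := h' w
        have := h' t₁
        grind
    · exact Or.inr fun w => by
        have := h' w
        have := h' t₁
        grind

/-- No switch of the colours on a set of vertices increases the number of bichromatic edges. -/
def MaxCut (G : SimpleGraph V) (c : V → Bool) : Prop :=
  ∀ (X : V → Prop) (L K : Finset (V × V)),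
    (∀ p ∈ L, X p.1 ∧ ¬ X p.2 ∧ G.Adj p.1 p.2 ∧ c p.1 = c p.2) →
    (∀ a b, X a → ¬ X b → G.Adj a b → c a ≠ c b → (a, b) ∈ K) → L.card ≤ K.card

lemma exists_maxCut [Finite V] (G : SimpleGraph V) : ∃ c, MaxCut G c := by
  classical
  have := Fintype.ofFinite V
  let mono : (V → Bool) → Finset (V × V) := fun c => {p | G.Adj p.1 p.2 ∧ c p.1 = c p.2}
  have hmono : ∀ c a b, (a, b) ∈ mono c ↔ G.Adj a b ∧ c a = c b := fun c a b => by simp [mono]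
  obtain ⟨c, hmin⟩ := Finite.exists_min fun c => (mono c).card
  refine ⟨c, fun X L K hL hK => ?_⟩
  let c₂ : V → Bool := fun a => if X a then !c a else c a
  have hcard : ∀ c, (mono c).card = {p ∈ mono c | X p.1 ↔ X p.2}.card +
      2 * {p ∈ mono c | X p.1 ∧ ¬ X p.2}.card := by
    intro c
    have h1 : {p ∈ mono c | X p.2 ∧ ¬ X p.1}.card = {p ∈ mono c | X p.1 ∧ ¬ X p.2}.card := by
      refine Finset.card_equiv (Equiv.prodComm V V) ?_
      rintro ⟨a, b⟩
      simp [hmono, G.adj_comm a b, eq_comm (a := c a)]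
    rw [two_mul]
    nth_rewrite 2 [← h1]
    rw [← Finset.card_union_of_disjoint, ← Finset.card_union_of_disjoint]
    · congr 1
      ext p
      simp only [Finset.mem_union, Finset.mem_filter]
      tauto
    · rw [Finset.disjoint_left]
      simp only [Finset.mem_union, Finset.mem_filter]
      tauto
    · rw [Finset.disjoint_left]
      simp only [Finset.mem_filter]
      tauto
  have hin : {p ∈ mono c | X p.1 ↔ X p.2} = {p ∈ mono c₂ | X p.1 ↔ X p.2} := by
    ext ⟨a, b⟩
    by_cases ha : X a <;> by_cases hb : X b <;> simp [hmono, c₂, ha, hb]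
  have hL' : L.card ≤ {p ∈ mono c | X p.1 ∧ ¬ X p.2}.card := by
    refine Finset.card_le_card fun p hp => ?_
    obtain ⟨a, b⟩ := p
    have := hL _ hp
    simp only [Finset.mem_filter, hmono]
    tauto
  have hK' : {p ∈ mono c₂ | X p.1 ∧ ¬ X p.2}.card ≤ K.card := by
    refine Finset.card_le_card fun p hp => ?_
    obtain ⟨a, b⟩ := p
    simp only [Finset.mem_filter, hmono, c₂] at hp
    have := hK a b
    grind
  have := hmin c₂
  simp only [hcard c, hcard c₂, hin] at this
  omega

lemma MaxCut.one {G : SimpleGraph V} {c : V → Bool} (h : MaxCut G c) (X : V → Prop) {p q : V}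
    (hp : X p) (hq : ¬ X q) (hpq : G.Adj p q) (hc : c p = c q) :
    ∃ a b, X a ∧ ¬ X b ∧ G.Adj a b ∧ c a ≠ c b := by
  by_contra! hcon
  have := h X {(p, q)} ∅ (by grind) (by grind)
  simp at this

lemma MaxCut.two {G : SimpleGraph V} {c : V → Bool} (h : MaxCut G c) (X : V → Prop)
    {p q p' q' : V} (hp : X p) (hq : ¬ X q) (hpq : G.Adj p q) (hc : c p = c q)
    (hp' : X p') (hq' : ¬ X q') (hpq' : G.Adj p' q') (hc' : c p' = c q')
    (hne : p ≠ p' ∨ q ≠ q') (e f : V) :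
    ∃ a b, X a ∧ ¬ X b ∧ G.Adj a b ∧ c a ≠ c b ∧ (a ≠ e ∨ b ≠ f) := by
  classical
  by_contra! hcon
  have := h X {(p, q), (p', q')} {(e, f)} (by grind) (by grind)
  rw [Finset.card_pair (by grind)] at this
  simp at this

lemma MaxCut.exists_cut {G : SimpleGraph V} {c : V → Bool} (h : MaxCut G c) {v w : V}
    (hvw : G.Adj v w) : ∃ z, G.Adj v z ∧ c z ≠ c v := by
  by_cases hc : c v = c w
  · obtain ⟨a, b, rfl, -, hab, hc⟩ := h.one (· = v) rfl hvw.ne' hvw hc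
    exact ⟨b, hab, hc.symm⟩
  · exact ⟨w, hvw, fun h => hc h.symm⟩

lemma MaxCut.partner_unique {G : SimpleGraph V} {c : V → Bool} (h : MaxCut G c)
    (h3 : AtMostThree G) {v a b : V} (ha : G.Adj v a) (hb : G.Adj v b) (hca : c v = c a)
    (hcb : c v = c b) : a = b := by
  by_contra hab
  obtain ⟨d, hd⟩ := h3.exists_third ha hb hab
  obtain ⟨x, y, rfl, -, hxy, hc, hne⟩ := h.two (· = v) rfl ha.ne' ha hca rfl hb.ne' hb hcb
    (Or.inr hab) v d
  have := hd y hxy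
  grind

/-- Two vertices of one colour with the same two neighbours `t₁`, `t₂` of the other colour. -/
structure Fork (G : SimpleGraph V) (c : V → Bool) (u v t₁ t₂ : V) : Prop where
  ne : u ≠ v
  ne' : t₁ ≠ t₂
  color : c u = c v
  color₁ : c t₁ ≠ c u
  color₂ : c t₂ ≠ c u
  nbr : ∀ w, c w ≠ c u → (G.Adj u w ↔ w = t₁ ∨ w = t₂)
  nbr' : ∀ w, c w ≠ c u → (G.Adj v w ↔ w = t₁ ∨ w = t₂)

lemma Fork.symm {G : SimpleGraph V} {c : V → Bool} {u v t₁ t₂ : V} (h : Fork G c u v t₁ t₂) :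
    Fork G c v u t₁ t₂ := by
  obtain ⟨h1, h2, h3, h4, h5, h6, h7⟩ := h
  constructor <;> grind

lemma Fork.swap {G : SimpleGraph V} {c : V → Bool} {u v t₁ t₂ : V} (h : Fork G c u v t₁ t₂) :
    Fork G c u v t₂ t₁ := by
  obtain ⟨h1, h2, h3, h4, h5, h6, h7⟩ := h
  constructor <;> grind

lemma Clash.cases {G : SimpleGraph V} {c : V → Bool} (h3 : AtMostThree G) (hmc : MaxCut G c)
    {u v u' : V} (huv : u ≠ v) (h : Clash G c u v) (hnt : ¬ Twins G u v) (hu : G.Adj u u')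
    (hc : c u' = c u) :
    (∃ t, c t ≠ c u ∧ (∀ w, G.Adj u w ↔ w = t ∨ w = u') ∧ ∀ w, G.Adj v w ↔ w = t) ∨
      ∃ t₁ t₂, Fork G c u v t₁ t₂ := by
  have hsymm : ∀ a b, G.Adj a b → G.Adj b a := fun a b h => h.symm
  obtain ⟨hcuv, hw⟩ := h
  obtain ⟨t, ht, hct⟩ := hmc.exists_cut hu
  have hvt : G.Adj v t := (hw t hct).1 ht
  by_cases h2 : ∃ t₂, t₂ ≠ t ∧ G.Adj u t₂ ∧ c t₂ ≠ c u
  · obtain ⟨t₂, hne, ht₂, hct₂⟩ := h2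
    have hnb : ∀ w, G.Adj u w → w = u' ∨ w = t ∨ w = t₂ :=
      fun w hw => h3.nbr_eq hu ht ht₂ (by grind) (by grind) hne.symm hw
    refine Or.inr ⟨t, t₂, huv, hne.symm, hcuv, hct, hct₂, ?_, ?_⟩ <;> grind
  · have hnb : ∀ w, G.Adj u w → w = u' ∨ w = t := by
      intro w hw
      by_cases hcw : c w = c u
      · exact Or.inl (hmc.partner_unique h3 hw hu hcw.symm hc.symm)
      · grind
    left
    refine ⟨t, hct, by grind, ?_⟩
    by_contra hcon
    obtain ⟨v', hv', hv't⟩ : ∃ v', G.Adj v v' ∧ v' ≠ t := by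
      by_contra! hcon2
      exact hcon (by grind)
    have hcv' : c v' = c v := by grind
    have hnv : ∀ w, G.Adj v w → w = v' ∨ w = t := by
      intro w hw
      by_cases hcw : c w = c v
      · exact Or.inl (hmc.partner_unique h3 hw hv' hcw.symm hcv'.symm)
      · grind
    by_cases hvu : v' = u
    · subst hvu
      have := hmc.partner_unique h3 (hsymm _ _ hv') hu hcv' hc.symm
      exact hnt (Or.inr (by grind))
    have huv' : u' ≠ v := by
      rintro rfl
      exact hvu (hmc.partner_unique h3 hv' (hsymm _ _ hu) hcv'.symm hc)
    obtain ⟨d, hd⟩ := h3.exists_third (hsymm _ _ ht) (hsymm _ _ hvt) huv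
    have hut := hu.ne
    have hvt := hv'.ne
    obtain ⟨a, b, ha, hb, hab, hcab, hne⟩ := hmc.two (fun w => w = u ∨ w = v ∨ w = t)
      (p := u) (q := u') (p' := v) (q' := v')
      (by grind) (by grind) hu hc.symm (by grind) (by grind) hv' hcv'.symm (Or.inl huv) t d
    have := hd b
    grind

section
variable {G : SimpleGraph V} {c : V → Bool} {u v t₁ t₂ u' v' : V}

lemma Fork.bichromatic (h3 : AtMostThree G) (hmc : MaxCut G c) (h : Fork G c u v t₁ t₂)
    (hu : G.Adj u u') (hc : c u' = c u) (huv : u' ≠ v) {w : V} (hw : G.Adj t₁ w) :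
    c w ≠ c t₁ := by
  have hsymm : ∀ a b, G.Adj a b → G.Adj b a := fun a b h => h.symm
  obtain ⟨h1, h2, hcuv, hc1, hc2, h6, h7⟩ := h
  intro hcw
  have hne := hu.ne
  have hnw := hw.ne
  obtain ⟨d, hd⟩ := h3.exists_third (v := t₂) (a := u) (b := v) (by grind) (by grind) h1
  have hd1 := fun e => @AtMostThree.nbr_eq _ _ h3 t₁ u v w (by grind) (by grind) hw h1
    (by grind) (by grind) e
  by_cases hwt : w = t₂
  · subst hwt
    have := hd t₁
    obtain ⟨a, b, ha, hb, hab, hcab⟩ := hmc.one (fun w' => w' = u ∨ w' = v ∨ w' = t₁ ∨ w' = w)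
      (p := u) (q := u') (by grind) (by grind) hu hc.symm
    have := hd b
    have := hd1 b
    grind
  · obtain ⟨a, b, ha, hb, hab, hcab, hne⟩ := hmc.two
      (fun w' => w' = u ∨ w' = v ∨ w' = t₁ ∨ w' = t₂)
      (p := u) (q := u') (p' := t₁) (q' := w)
      (by grind) (by grind) hu hc.symm (by grind) (by grind) hw hcw.symm (by grind) t₂ d
    have := hd b
    have := hd1 b
    grind

lemma Fork.exists_third (h3 : AtMostThree G) (hmc : MaxCut G c) (h : Fork G c u v t₁ t₂)
    (hu : G.Adj u u') (hc : c u' = c u) (huv : u' ≠ v) (hv : G.Adj v v') (hcv : c v' = c v) :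
    ∃ w, G.Adj t₁ w ∧ w ≠ u ∧ w ≠ v := by
  have hsymm : ∀ a b, G.Adj a b → G.Adj b a := fun a b h => h.symm
  have hvu : v' ≠ u := by
    rintro rfl
    exact huv (hmc.partner_unique h3 hu hv.symm hc.symm hcv)
  obtain ⟨h1, h2, hcuv, hc1, hc2, h6, h7⟩ := h
  by_contra! hcon
  have hne := hu.ne
  have hne' := hv.ne
  obtain ⟨d, hd⟩ := h3.exists_third (v := t₂) (a := u) (b := v) (by grind) (by grind) h1
  obtain ⟨a, b, ha, hb, hab, hcab, hne⟩ := hmc.two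
    (fun w' => w' = u ∨ w' = v ∨ w' = t₁ ∨ w' = t₂)
    (p := u) (q := u') (p' := v) (q' := v')
    (by grind) (by grind) hu hc.symm (by grind) (by grind) hv hcv.symm (by grind) t₂ d
  have := hd b
  have := hcon b
  grind

end

/-- The graph obtained from `G` by isolating the vertices of `S` and then joining `p` to `q`. -/
def isolateJoin (G : SimpleGraph V) (S : Set V) (p q : V) : SimpleGraph V :=
  isolate G S ⊔ edge p q

lemma isolateJoin_adj {G : SimpleGraph V} {S : Set V} {p q : V} (hpq : p ≠ q) (a b : V) :
    (isolateJoin G S p q).Adj a b ↔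
      (G.Adj a b ∧ a ∉ S ∧ b ∉ S) ∨ (a = p ∧ b = q) ∨ (a = q ∧ b = p) := by
  simp only [isolateJoin, sup_adj, edge_adj, isolate]
  grind

lemma isolateJoin_support_ssubset {G : SimpleGraph V} {S : Set V} {x y p q : V} (hx : x ∈ S)
    (hxp : x ≠ p) (hxq : x ≠ q) (hpq : p ≠ q) (hxy : G.Adj x y) (hp : p ∈ G.support)
    (hq : q ∈ G.support) : (isolateJoin G S p q).support ⊂ G.support := by
  refine ⟨fun v hv => ?_, fun h => ?_⟩
  · obtain ⟨w, hw⟩ := (mem_support _).1 hv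
    rw [isolateJoin_adj hpq] at hw
    rcases hw with hw | ⟨rfl, -⟩ | ⟨rfl, -⟩
    · exact ⟨w, hw.1⟩
    · exact hp
    · exact hq
  · obtain ⟨w, hw⟩ := (mem_support _).1 (h ((mem_support G).2 ⟨y, hxy⟩))
    rw [isolateJoin_adj hpq] at hw
    grind

set_option maxHeartbeats 1000000 in
/-- Reduction of two adjacent vertices of degree three carrying the leaves `u` and `x`, where the
edge between them is subdivided by `v`. -/
lemma exists_good_of_subdivided {G : SimpleGraph V} {c' : V → Bool} {u v t s x t' z : V}
    (hu : ∀ w, G.Adj u w ↔ w = t) (hv : ∀ w, G.Adj v w ↔ w = t ∨ w = s)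
    (ht : ∀ w, G.Adj t w ↔ w = u ∨ w = v ∨ w = t') (hs : ∀ w, G.Adj s w ↔ w = v ∨ w = x ∨ w = z)
    (hx : ∀ w, G.Adj x w ↔ w = s) (htz : z ≠ t) (hzt : z ≠ t') (huv : u ≠ v) (hxv : x ≠ v)
    (hts : t ≠ s) (hut' : u ≠ t') (hvt' : v ≠ t') (hvz : v ≠ z) (hxz : x ≠ z)
    (hgood : Good (isolateJoin G {s, x, v} z t) c') : ∃ c, Good G c := by
  classical
  have hsymm : ∀ a b, G.Adj a b → G.Adj b a := fun a b h => h.symm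
  have hirr : ∀ a, ¬ G.Adj a a := fun a => G.loopless.irrefl a
  have hadj := @isolateJoin_adj V G {s, x, v} z t htz
  set G' := isolateJoin G {s, x, v} z t with hG'
  simp only [Set.mem_insert_iff, Set.mem_singleton_iff] at hadj
  clear_value G'
  clear hG'
  have a1 : G.Adj u t := (hu t).2 rfl
  have a2 : G.Adj v t := (hv t).2 (Or.inl rfl)
  have a3 : G.Adj v s := (hv s).2 (Or.inr rfl)
  have a4 : G.Adj t t' := (ht t').2 (Or.inr (Or.inr rfl))
  have a5 : G.Adj s z := (hs z).2 (Or.inr (Or.inr rfl))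
  have a6 : G.Adj x s := (hx s).2 rfl
  have h1 := hirr u
  have h2 := hirr v
  have h3 := hirr t
  have h4 := hirr s
  have h5 := hirr x
  have h6 := hirr z
  have h7 := hirr t'
  have hux : u ≠ x := by grind
  have hut : u ≠ t := by grind
  have hus : u ≠ s := by grind
  have huz : u ≠ z := by grind
  have hvt : v ≠ t := by grind
  have hvs : v ≠ s := by grind
  have htx : t ≠ x := by grind
  have htt' : t ≠ t' := by grind
  have hsx : s ≠ x := by grind
  have hsz : s ≠ z := by grind
  have hst' : s ≠ t' := by grind
  have hxt' : x ≠ t' := by grind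
  clear h1 h2 h3 h4 h5 h6 h7
  obtain ⟨σ, hσ⟩ : ∃ σ : Bool, (c' z = c' t' → σ = !c' z) ∧ (c' z ≠ c' t' → σ = c' t) :=
    ⟨if c' z = c' t' then !c' z else c' t, by grind⟩
  obtain ⟨c, hcs, hct, hcv, hcx, hcu, hc⟩ : ∃ c : V → Bool, c s = σ ∧ c t = σ ∧ c v = (!σ) ∧
      c x = (!σ) ∧ c u = (!σ) ∧ ∀ a, a ≠ s → a ≠ t → a ≠ v → a ≠ x → a ≠ u → c a = c' a :=
    ⟨fun a => if a = s ∨ a = t then σ else if a = v ∨ a = x ∨ a = u then !σ else c' a, by grind⟩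
  have hR : ∀ a, a ∈ ({s, x, v, t, u} : Set V) ↔ a = s ∨ a = x ∨ a = v ∨ a = t ∨ a = u := by
    simp
  have hcz : c z = c' z := hc z hsz.symm htz hvz.symm hxz.symm huz.symm
  have hct' : c t' = c' t' := hc t' hst'.symm htt'.symm hvt'.symm hxt'.symm hut'.symm
  have hu' : ∀ w, G'.Adj u w ↔ w = t := by grind
  have ht' : ∀ w, G'.Adj t w ↔ w = u ∨ w = z ∨ w = t' := by grind
  have key : ∀ b y, (b = z ∧ y = s) ∨ (b = t' ∧ y = t) → c b = (!σ) →
      (∀ w, G.Adj b w → c w = σ → w = y) → ∀ w, G.Adj b w → w = y := by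
    intro b y hb hcb hw
    have hw' : ∀ w, G'.Adj b w → c' w ≠ c' b → w = t := by
      intro w hbw hcw
      by_contra hwt
      have hb2 : b ≠ t ∧ b ≠ u ∧ c' b = !σ := by
        rcases hb with ⟨rfl, rfl⟩ | ⟨rfl, rfl⟩
        · exact ⟨htz, huz.symm, hcz ▸ hcb⟩
        · exact ⟨htt'.symm, hut'.symm, hct' ▸ hcb⟩
      have hbw' : G.Adj b w ∧ w ≠ s ∧ w ≠ x ∧ w ≠ v := by
        have := (hadj b w).1 hbw
        grind
      have hwu : w ≠ u := by
        rintro rfl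
        exact hb2.1 ((hu b).1 hbw'.1.symm)
      have hcw' : c w = c' w := hc w hbw'.2.1 hwt hbw'.2.2.2 hbw'.2.2.1 hwu
      have := hw w hbw'.1
      have : w ≠ y := by grind
      have hwσ : c' w = σ := by
        rw [hb2.2.2] at hcw
        exact by simpa using Bool.eq_not_of_ne hcw
      grind
    obtain ⟨w, hw1, hw2⟩ := hgood.1 b t (by grind)
    obtain rfl := hw' w hw1 hw2
    obtain ⟨w2, hw3, hw4⟩ := hgood.1 u w (by grind)
    obtain rfl : w2 = w := (hu' w2).1 hw3
    have hcbu : c' b = c' u := by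
      rw [Bool.eq_not_of_ne hw2.symm, Bool.eq_not_of_ne hw4.symm]
    rcases hgood.2 b u (by grind) ⟨hcbu, by grind⟩ with h | h
    · intro w
      have := h w
      grind
    · have := h u
      grind
  refine ⟨c, good_of_extend {s, x, v, t, u} (G' := G') (c' := c') ?_ hgood ?_ ?_ ?_ ?_ ?_ ?_ ?_⟩
  all_goals simp only [hR]
  · grind
  · grind
  · grind
  · rintro w r hw hr hwr hcr
    have : w = z ∨ w = t' := by grind
    rcases this with rfl | rfl
    · exact ⟨s, by grind⟩
    · exact ⟨t, by grind⟩
  · intro w r hw hr hwr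
    exact Or.inl ⟨t, by grind⟩
  · intro a b ha hb hab hcab htw
    by_cases hz : a = z ∨ b = z ∨ a = t' ∨ b = t'
    · right; left
      have : (a = z ∧ b = t') ∨ (a = t' ∧ b = z) := by
        rcases htw with h | h
        all_goals
          have := h t
          grind
      rcases this with ⟨rfl, rfl⟩ | ⟨rfl, rfl⟩
      · exact ⟨s, by grind⟩
      · exact ⟨t, by grind⟩
    · left
      rcases htw with h | h
      · exact Or.inl fun w => by
          have := h w
          grind
      · exact Or.inr fun w => by
          have := h w
          grind
  · intro r hr w hw
    rcases hr with rfl | rfl | rfl | rfl | rfl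
    · exact ⟨x, by grind⟩
    · exact ⟨s, by grind⟩
    · exact ⟨s, by grind⟩
    · exact ⟨u, by grind⟩
    · exact ⟨t, by grind⟩
  · intro r hr b hbr hcl
    obtain ⟨hcb, hcl⟩ := hcl
    rcases hr with rfl | rfl | rfl | rfl | rfl
    · have := hcl x
      grind
    · have := hcl s
      have := hcl t
      have hbz : b = z := by grind
      subst hbz
      have := key b s (by grind) (by grind) (by grind)
      exact Or.inl (by grind)
    · have := hcl s
      have := hcl t
      grind
    · have := hcl u
      grind
    · have := hcl s
      have := hcl t
      have hbz : b = t' := by grind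
      subst hbz
      have := key b t (by grind) (by grind) (by grind)
      exact Or.inl (by grind)

/-- Every subcubic graph with smaller support has a good colouring. -/
def SmallerGood (G : SimpleGraph V) : Prop :=
  ∀ G' : SimpleGraph V, AtMostThree G' → G'.support ⊂ G.support → ∃ c, Good G' c

lemma isolate_pair_adj {G : SimpleGraph V} {s x : V} (a b : V) :
    (isolate G {s, x}).Adj a b ↔ G.Adj a b ∧ a ≠ s ∧ a ≠ x ∧ b ≠ s ∧ b ≠ x := by
  simp only [isolate, Set.mem_insert_iff, Set.mem_singleton_iff]
  tauto

lemma SmallerGood.of_leaf {G : SimpleGraph V} (hG : SmallerGood G) (h3 : AtMostThree G)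
    {x s y : V} (hx : ∀ w, G.Adj x w ↔ w = s) (hsy : G.Adj s y) (hyx : y ≠ x)
    (htwin : ∀ w, G.Adj s w → w ≠ x → w ≠ y → (∃ z, z ≠ s ∧ G.Adj w z) ∧
      ∀ b, b ≠ w → b ≠ s → b ≠ x → Twins (isolate G {s, x}) w b → Twins G w b) :
    ∃ c, Good G c := by
  obtain ⟨c', hc'⟩ := hG (isolate G {s, x}) (isolate_atMostThree h3 _)
    (isolate_support_ssubset (x := s) (by simp) hsy)
  exact exists_good_of_leaf hx hsy hyx hc' htwin

section
variable {G : SimpleGraph V} {c : V → Bool} {u v s t x z t' : V}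

lemma MaxCut.exists_third_of_leaf (hmc : MaxCut G c) (hx : ∀ w, G.Adj x w ↔ w = s)
    (hsv : G.Adj s v) (hc : c s = c v) (hvx : v ≠ x) :
    ∃ z, G.Adj s z ∧ c z ≠ c s ∧ z ≠ v ∧ z ≠ x := by
  have hne := hsv.ne
  obtain ⟨a, b, ha, hb, hab, hcab⟩ := hmc.one (fun w => w = s ∨ w = x) (p := s) (q := v)
    (by grind) (by grind) hsv hc
  exact ⟨b, by grind⟩

lemma SmallerGood.of_leaf_clash (hG : SmallerGood G) (h3 : AtMostThree G) (hmc : MaxCut G c)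
    (huv : u ≠ v) (hu : ∀ w, G.Adj u w ↔ w = t) (hv : ∀ w, G.Adj v w ↔ w = t ∨ w = s)
    (hcs : c s = c v) (hct : c t ≠ c v) (hcu : c u = c v) : ∃ c, Good G c := by
  have hsymm : ∀ a b, G.Adj a b → G.Adj b a := fun a b h => h.symm
  have hirr : ∀ a, ¬ G.Adj a a := fun a => G.loopless.irrefl a
  have hut : G.Adj t u := hsymm _ _ ((hu t).2 rfl)
  have hvt : G.Adj t v := hsymm _ _ ((hv t).2 (Or.inl rfl))
  have hvs : G.Adj v s := (hv s).2 (Or.inr rfl)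
  have hnvs := hvs.ne
  have hnut := hut.ne
  have hnvt := hvt.ne
  have hts : t ≠ s := by grind
  obtain ⟨t', htt', hct', ht'u, ht'v⟩ : ∃ t', G.Adj t t' ∧ c t' ≠ c t ∧ t' ≠ u ∧ t' ≠ v := by
    obtain ⟨a, b, ha, hb, hab, hcab⟩ := hmc.one (fun w => w = u ∨ w = v ∨ w = t)
      (p := v) (q := s) (by grind) (by grind) hvs hcs.symm
    exact ⟨b, by grind⟩
  have htN : ∀ w, G.Adj t w ↔ w = u ∨ w = v ∨ w = t' := fun w =>
    ⟨fun h => h3.nbr_eq hut hvt htt' huv ht'u.symm ht'v.symm h, by grind⟩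
  have hadj := @isolate_pair_adj V G
  by_contra hcon
  obtain ⟨b, hbv, hbt, hbu, htw, hntw⟩ : ∃ b, b ≠ v ∧ b ≠ t ∧ b ≠ u ∧
      Twins (isolate G {t, u}) v b ∧ ¬ Twins G v b := by
    by_contra! hcon2
    refine hcon (hG.of_leaf h3 hu htt' ht'u fun w hw hwu hwt' => ?_)
    obtain rfl : w = v := by grind
    exact ⟨⟨s, hts.symm, hvs⟩, hcon2⟩
  have hus : u ≠ s := by
    rintro rfl
    have := (hu v).1 (by grind)
    grind
  have hb : ∀ w, G.Adj b w ↔ w = s := by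
    rcases htw with htw | htw
    · simp only [hadj] at htw
      have hbt' : ¬ G.Adj b t := by
        intro hbt'
        refine hntw (Or.inl fun w => ?_)
        have := htw w
        grind
      intro w
      have := htw w
      grind
    · simp only [hadj] at htw
      exfalso
      have hbs : b = s := by
        have := htw v
        grind
      subst hbs
      by_cases hbt' : G.Adj b t
      · refine hntw (Or.inr fun w => ?_)
        have := htw w
        grind
      · obtain ⟨w, hw1, hw2⟩ := hmc.exists_cut (hsymm _ _ hvs)
        have := htw w
        grind
  obtain ⟨z, hsz, hcz, hzv, hzb⟩ := hmc.exists_third_of_leaf hb (hsymm _ _ hvs) hcs hbv.symm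
  have hbs : G.Adj s b := hsymm _ _ ((hb s).2 rfl)
  have hsN : ∀ w, G.Adj s w ↔ w = v ∨ w = b ∨ w = z := fun w =>
    ⟨fun h => h3.nbr_eq (hsymm _ _ hvs) hbs hsz hbv.symm hzv.symm hzb.symm h, by grind⟩
  by_cases hzt : z = t
  · subst hzt
    refine hcon (hG.of_leaf h3 hu hvt huv.symm fun w hw hwu hwv => ?_)
    obtain rfl : w = s := by grind
    refine ⟨⟨b, hbt, hbs⟩, fun a haw haz hau htw => ?_⟩
    exfalso
    simp only [Twins, hadj] at htw
    have := htw.imp (fun h => h b) (fun h => h b)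
    have := htw.imp (fun h => h v) (fun h => h v)
    grind
  have hzt' : z ≠ t' := by
    rintro rfl
    exact hcz (by rw [Bool.eq_not_of_ne hct', Bool.eq_not_of_ne hct, Bool.not_not, hcs])
  obtain ⟨c', hc'⟩ := hG (isolateJoin G {s, b, v} z t) (by
      intro a
      obtain ⟨p, q, r, hpqr⟩ := h3 z
      have := hpqr s (hsymm _ _ hsz)
      have hadj := @isolateJoin_adj V G {s, b, v} z t hzt
      simp only [Set.mem_insert_iff, Set.mem_singleton_iff] at hadj
      by_cases hat : a = t
      · exact ⟨u, t', z, by grind⟩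
      by_cases haz : a = z
      · rcases this with h | h | h
        · exact ⟨t, q, r, by grind⟩
        · exact ⟨p, t, r, by grind⟩
        · exact ⟨p, q, t, by grind⟩
      · obtain ⟨p, q, r, hpqr⟩ := h3 a
        exact ⟨p, q, r, by grind⟩)
    (isolateJoin_support_ssubset (x := b) (by simp) hzb.symm hbt hzt ((hb s).2 rfl)
      ((mem_support G).2 ⟨s, hsymm _ _ hsz⟩) ((mem_support G).2 ⟨u, hut⟩))
  exact hcon (exists_good_of_subdivided hu hv htN hsN hb hzt hzt' huv hbv hts ht'u.symm ht'v.symm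
    hzv.symm hzb.symm hc')

end

set_option maxHeartbeats 4000000 in
/-- Reduction of a vertex `s` with a leaf `x`, adjacent to a vertex `u` of a four-cycle
`u t₁ v t₂` in which `v` has degree two. -/
lemma exists_good_of_fourCycle {G G' : SimpleGraph V} {c' : V → Bool} {u v t₁ t₂ s x y : V}
    (hx : ∀ w, G.Adj x w ↔ w = s) (hs : ∀ w, G.Adj s w ↔ w = u ∨ w = x ∨ w = y)
    (hu : ∀ w, G.Adj u w ↔ w = s ∨ w = t₁ ∨ w = t₂) (hv : ∀ w, G.Adj v w ↔ w = t₁ ∨ w = t₂)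
    (h₁ : ∀ p q, G.Adj t₁ p → G.Adj t₁ q → p ≠ u → p ≠ v → q ≠ u → q ≠ v → p = q)
    (h₂ : ∀ p q, G.Adj t₂ p → G.Adj t₂ q → p ≠ u → p ≠ v → q ≠ u → q ≠ v → p = q)
    (h₁₂ : ∀ p, G.Adj t₁ p → G.Adj t₂ p → p = u ∨ p = v)
    (hleaf : ∀ p, G.Adj t₂ p → p ≠ u → p ≠ v → ∃ z, z ≠ t₂ ∧ G.Adj p z)
    (hst₁ : ¬ G.Adj s t₁) (hst₂ : ¬ G.Adj s t₂) (hyt₁ : ¬ G.Adj y t₁) (hyt₂ : ¬ G.Adj y t₂)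
    (ht₁₂ : ¬ G.Adj t₁ t₂) (htt : t₁ ≠ t₂) (huv : u ≠ v) (hsv : s ≠ v) (hux : u ≠ x)
    (huy : u ≠ y) (hxy : x ≠ y)
    (hadj : ∀ a b, G'.Adj a b ↔
      (G.Adj a b ∧ a ≠ u ∧ a ≠ v ∧ a ≠ t₁ ∧ a ≠ t₂ ∧ b ≠ u ∧ b ≠ v ∧ b ≠ t₁ ∧ b ≠ t₂) ∨
      (a = s ∧ G.Adj t₁ b ∧ b ≠ u ∧ b ≠ v) ∨ (b = s ∧ G.Adj t₁ a ∧ a ≠ u ∧ a ≠ v))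
    (hgood : Good G' c') : ∃ c, Good G c := by
  classical
  have hsymm : ∀ a b, G.Adj a b → G.Adj b a := fun a b h => h.symm
  have hirr : ∀ a, ¬ G.Adj a a := fun a => G.loopless.irrefl a
  have a1 : G.Adj s u := (hs u).2 (Or.inl rfl)
  have a2 : G.Adj s x := (hs x).2 (Or.inr (Or.inl rfl))
  have a3 : G.Adj s y := (hs y).2 (Or.inr (Or.inr rfl))
  have a4 : G.Adj u t₁ := (hu t₁).2 (Or.inr (Or.inl rfl))
  have a5 : G.Adj u t₂ := (hu t₂).2 (Or.inr (Or.inr rfl))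
  have a6 : G.Adj v t₁ := (hv t₁).2 (Or.inl rfl)
  have a7 : G.Adj v t₂ := (hv t₂).2 (Or.inr rfl)
  have hsu := a1.ne
  have hsx := a2.ne
  have hsy := a3.ne
  have hut₁ := a4.ne
  have hut₂ := a5.ne
  have hvt₁ := a6.ne
  have hvt₂ := a7.ne
  have hst₁' : s ≠ t₁ := by rintro rfl; grind
  have hst₂' : s ≠ t₂ := by rintro rfl; grind
  have hxv : x ≠ v := by rintro rfl; grind
  have hxt₁ : x ≠ t₁ := by rintro rfl; grind
  have hxt₂ : x ≠ t₂ := by rintro rfl; grind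
  have hyv : y ≠ v := by rintro rfl; grind
  have hyt₁' : y ≠ t₁ := by rintro rfl; grind
  have hyt₂' : y ≠ t₂ := by rintro rfl; grind
  have hbool : ∀ b d : Bool, b ≠ d → b = !d := fun b d h => Bool.eq_not_of_ne h
  obtain ⟨β, hβ⟩ : ∃ β, ∀ p, G.Adj t₁ p → p ≠ u → p ≠ v → c' p = β := by
    by_cases h : ∃ p, G.Adj t₁ p ∧ p ≠ u ∧ p ≠ v
    · obtain ⟨p, hp⟩ := h
      exact ⟨c' p, fun q hq1 hq2 hq3 => by rw [h₁ p q hp.1 hq1 hp.2.1 hp.2.2 hq2 hq3]⟩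
    · exact ⟨true, by grind⟩
  obtain ⟨γ, hγ⟩ : ∃ γ, ∀ p, G.Adj t₂ p → p ≠ u → p ≠ v → c' p = γ := by
    by_cases h : ∃ p, G.Adj t₂ p ∧ p ≠ u ∧ p ≠ v
    · obtain ⟨p, hp⟩ := h
      exact ⟨c' p, fun q hq1 hq2 hq3 => by rw [h₂ p q hp.1 hq1 hp.2.1 hp.2.2 hq2 hq3]⟩
    · exact ⟨true, by grind⟩
  obtain ⟨σ, hσ₁, hσ₂⟩ : ∃ σ : Bool, (β = γ → c' s = c' y → σ ≠ β) ∧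
      (¬ (β = γ ∧ c' s = c' y) → σ = c' s) :=
    ⟨if β = γ ∧ c' s = c' y then !β else c' s, by grind⟩
  obtain ⟨τ₁, τ₂, ν, hcase⟩ : ∃ τ₁ τ₂ ν : Bool,
      (σ ≠ β ∧ σ ≠ γ ∧ τ₁ = σ ∧ τ₂ = σ ∧ ν = !σ) ∨
      (σ = γ ∧ τ₁ = σ ∧ τ₂ = (!σ) ∧ ν = σ) ∨
      (σ = β ∧ σ ≠ γ ∧ σ = c' s ∧ τ₁ = (!σ) ∧ τ₂ = σ ∧ ν = σ) := by
    by_cases h1 : σ = γ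
    · exact ⟨σ, !σ, σ, by grind⟩
    by_cases h2 : σ = β
    · exact ⟨!σ, σ, σ, by grind⟩
    · exact ⟨σ, σ, !σ, by grind⟩
  obtain ⟨c, hcs, hcx, hcu, hcv, hct₁, hct₂, hc⟩ : ∃ c : V → Bool, c s = σ ∧ c x = (!σ) ∧
      c u = (!σ) ∧ c v = ν ∧ c t₁ = τ₁ ∧ c t₂ = τ₂ ∧
      ∀ a, a ≠ u → a ≠ v → a ≠ t₁ → a ≠ t₂ → a ≠ s → a ≠ x → c a = c' a :=
    ⟨fun a => if a = s then σ else if a = x ∨ a = u then !σ else if a = v then ν else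
      if a = t₁ then τ₁ else if a = t₂ then τ₂ else c' a, by grind⟩
  have hR : ∀ a, a ∈ ({u, v, t₁, t₂, s, x} : Set V) ↔
      a = u ∨ a = v ∨ a = t₁ ∨ a = t₂ ∨ a = s ∨ a = x := by simp
  have hp₁ : ∀ p, G.Adj t₁ p → p ≠ u → p ≠ v → p ≠ t₁ ∧ p ≠ t₂ ∧ p ≠ s ∧ p ≠ x ∧ p ≠ y := by
    intro p hp hpu hpv
    refine ⟨?_, ?_, ?_, ?_, ?_⟩ <;> rintro rfl <;> grind
  have hp₂ : ∀ p, G.Adj t₂ p → p ≠ u → p ≠ v → p ≠ t₁ ∧ p ≠ t₂ ∧ p ≠ s ∧ p ≠ x ∧ p ≠ y := by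
    intro p hp hpu hpv
    refine ⟨?_, ?_, ?_, ?_, ?_⟩ <;> rintro rfl <;> grind
  have serve₁ : ∀ p, G.Adj t₁ p → p ≠ u → p ≠ v → ¬ (σ = γ ∧ σ = β) → c t₁ ≠ c p := by
    intro p hp hpu hpv
    have := hp₁ p hp hpu hpv
    have := hc p
    have := hβ p hp hpu hpv
    rcases hcase with h | h | h <;> grind
  have serve₂ : ∀ p, G.Adj t₂ p → p ≠ u → p ≠ v → c t₂ ≠ c p := by
    intro p hp hpu hpv
    have := hp₂ p hp hpu hpv
    have := hc p
    have := hγ p hp hpu hpv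
    rcases hcase with h | h | h <;> grind
  have nbr_y : ∀ w, G'.Adj y w ↔ G.Adj y w := by
    intro w
    have := hp₁ w
    have := hp₁ y
    rw [hadj]
    constructor
    · grind
    · intro h
      refine Or.inl ⟨h, huy.symm, hyv, hyt₁', hyt₂', ?_, ?_, ?_, ?_⟩ <;> rintro rfl <;> grind
  have nbr_p₂ : ∀ p w, G.Adj t₂ p → p ≠ u → p ≠ v → (G'.Adj p w ↔ G.Adj p w ∧ w ≠ t₂) := by
    intro p w hp hpu hpv
    have := hp₂ p hp hpu hpv
    have := h₁₂ p
    rw [hadj]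
    constructor
    · grind
    · intro h
      refine Or.inl ⟨h.1, hpu, hpv, by grind, by grind, ?_, ?_, ?_, h.2⟩ <;> rintro rfl <;> grind
  have nbr_p₁ : ∀ p w, G.Adj t₁ p → p ≠ u → p ≠ v →
      (G'.Adj p w ↔ w = s ∨ (G.Adj p w ∧ w ≠ t₁)) := by
    intro p w hp hpu hpv
    have := hp₁ p hp hpu hpv
    have := h₁₂ p
    rw [hadj]
    constructor
    · grind
    · rintro (h | h)
      · grind
      refine Or.inl ⟨h.1, hpu, hpv, by grind, by grind, ?_, ?_, h.2, ?_⟩ <;> rintro rfl <;> grind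
  have nbr_o : ∀ a w, a ≠ u → a ≠ v → a ≠ t₁ → a ≠ t₂ → a ≠ s → ¬ G.Adj t₁ a → ¬ G.Adj t₂ a →
      (G'.Adj a w ↔ G.Adj a w) := by
    intro a w h1 h2 h3 h4 h5 h6 h7
    rw [hadj]
    constructor
    · grind
    · intro h
      refine Or.inl ⟨h, h1, h2, h3, h4, ?_, ?_, ?_, ?_⟩ <;> rintro rfl <;> grind
  have nbr_s : ∀ w, G'.Adj s w → w = x ∨ w = y ∨ (G.Adj t₁ w ∧ w ≠ u ∧ w ≠ v) := by
    intro w hw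
    rw [hadj] at hw
    have := hp₁ s
    grind
  have key : c y = (!σ) → (∀ w, G.Adj y w → c w = σ → w = s) → ∀ w, G.Adj y w → w = s := by
    intro hcy hw
    have hcy' : c' y = !σ := by rw [← hcy, hc y huy.symm hyv hyt₁' hyt₂' hsy.symm hxy.symm]
    have hw' : ∀ w, G'.Adj y w → c' w ≠ c' y → w = s := by
      intro w hyw hcw
      by_contra hws
      have hyw' := (nbr_y w).1 hyw
      have hwx : w ≠ x := by rintro rfl; grind
      have hwR := (hadj y w).1 hyw
      have hcw' : c w = c' w := hc w (by grind) (by grind) (by grind) (by grind) hws hwx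
      refine hws (hw w hyw' ?_)
      rw [hcw', hbool _ _ hcw, hcy', Bool.not_not]
    have hys : G'.Adj y s := (nbr_y s).2 (hsymm _ _ a3)
    have nbr_x : ∀ w, G'.Adj x w ↔ w = s := by
      intro w
      rw [nbr_o x w hux.symm hxv hxt₁ hxt₂ hsx.symm (by grind) (by grind)]
      exact hx w
    obtain ⟨w, hw1, hw2⟩ := hgood.1 y s hys
    obtain rfl := hw' w hw1 hw2
    obtain ⟨w2, hw3, hw4⟩ := hgood.1 x w ((nbr_x w).2 rfl)
    obtain rfl : w2 = w := (nbr_x w2).1 hw3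
    have hcyx : c' y = c' x := by rw [hbool _ _ hw2.symm, hbool _ _ hw4.symm]
    rcases hgood.2 y x hxy.symm ⟨hcyx, by grind⟩ with h | h
    · intro w
      have := h w
      grind
    · have := h x
      grind
  have twin₁ : ∀ a b, G.Adj t₁ a → a ≠ u → a ≠ v → b ≠ x → b ≠ s → a ≠ b → c' a = c' b →
      Twins G' a b → ¬ (σ = γ ∧ σ = β) := by
    rintro a b ha hau hav hbx hbs hab hcab htw ⟨hσγ, hσβ⟩
    have hbs : G'.Adj s b := by
      have hsa : G'.Adj a s := (nbr_p₁ a s ha hau hav).2 (Or.inl rfl)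
      rcases htw with h | h
      · exact ((h s).1 hsa).symm
      · exact (((h s).1 (Or.inr hsa)).resolve_left hbs.symm).symm
    have hba : b = y := by
      rcases nbr_s b hbs with h | h | h
      · exact (hbx h).elim
      · exact h
      · exact (hab (h₁ a b ha h.1 hau hav h.2.1 h.2.2)).elim
    subst hba
    have := hβ a ha hau hav
    grind
  refine ⟨c, good_of_extend {u, v, t₁, t₂, s, x} (G' := G') (c' := c') ?_ hgood ?_ ?_ ?_ ?_ ?_ ?_ ?_⟩
  all_goals simp only [hR]
  · grind
  · grind
  · intro r hr a b ha hb hra hrb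
    rcases hr with rfl | rfl | rfl | rfl | rfl | rfl <;> grind
  · intro w r hw hr hwr hcr
    simp only [not_or] at hw
    obtain ⟨hwu, hwv, hwt₁, hwt₂, hws, hwx⟩ := hw
    have hcw := hc w hwu hwv hwt₁ hwt₂ hws hwx
    have hrs : r = s := by
      have := (hadj w r).1 hwr
      have := hsymm w r
      grind
    subst hrs
    rcases nbr_s w hwr.symm with h | h | ⟨h4, h5, h6⟩
    · exact (hwx h).elim
    · subst h
      exact ⟨r, by grind, hsymm _ _ a3, by grind⟩
    · refine ⟨t₁, by grind, hsymm _ _ h4, serve₁ w h4 h5 h6 fun h => ?_⟩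
      have := hβ w h4 h5 h6
      grind
  · intro w r hw hr hwr
    simp only [not_or] at hw
    obtain ⟨hwu, hwv, hwt₁, hwt₂, hws, hwx⟩ := hw
    left
    have h : w = y ∨ G.Adj t₁ w ∨ G.Adj t₂ w := by
      have := hsymm _ _ hwr
      rcases hr with rfl | rfl | rfl | rfl | rfl | rfl <;> grind
    rcases h with rfl | h | h
    · exact ⟨s, (nbr_y s).2 (hsymm _ _ a3)⟩
    · exact ⟨s, (nbr_p₁ w s h hwu hwv).2 (Or.inl rfl)⟩
    · obtain ⟨z, hz⟩ := hleaf w h hwu hwv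
      exact ⟨z, (nbr_p₂ w z h hwu hwv).2 ⟨hz.2, hz.1⟩⟩
  · intro a b ha hb hab hcab htw
    simp only [not_or] at ha hb
    obtain ⟨hau, hav, hat₁, hat₂, has, hax⟩ := ha
    obtain ⟨hbu, hbv, hbt₁, hbt₂, hbs, hbx⟩ := hb
    by_cases hat₂' : G.Adj t₂ a
    · exact Or.inr (Or.inl ⟨t₂, by grind, hsymm _ _ hat₂', serve₂ a hat₂' hau hav⟩)
    by_cases hbt₂' : G.Adj t₂ b
    · exact Or.inr (Or.inr ⟨t₂, by grind, hsymm _ _ hbt₂', serve₂ b hbt₂' hbu hbv⟩)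
    by_cases hat₁' : G.Adj t₁ a
    · exact Or.inr (Or.inl ⟨t₁, by grind, hsymm _ _ hat₁', serve₁ a hat₁' hau hav
        (twin₁ a b hat₁' hau hav hbx hbs hab hcab htw)⟩)
    by_cases hbt₁' : G.Adj t₁ b
    · exact Or.inr (Or.inr ⟨t₁, by grind, hsymm _ _ hbt₁', serve₁ b hbt₁' hbu hbv
        (twin₁ b a hbt₁' hbu hbv hax has hab.symm hcab.symm htw.symm)⟩)
    left
    have hna := fun w => nbr_o a w hau hav hat₁ hat₂ has hat₁' hat₂'
    have hnb := fun w => nbr_o b w hbu hbv hbt₁ hbt₂ hbs hbt₁' hbt₂'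
    simpa only [Twins, hna, hnb] using htw
  · intro r hr w hw
    rcases hr with rfl | rfl | rfl | rfl | rfl | rfl
    · exact ⟨s, hsymm _ _ a1, by grind⟩
    · rcases hcase with h | h | h
      · exact ⟨t₁, a6, by grind⟩
      · exact ⟨t₂, a7, by grind⟩
      · exact ⟨t₁, a6, by grind⟩
    · rcases hcase with h | h | h
      · exact ⟨u, hsymm _ _ a4, by grind⟩
      · exact ⟨u, hsymm _ _ a4, by grind⟩
      · exact ⟨v, hsymm _ _ a6, by grind⟩
    · rcases hcase with h | h | h
      · exact ⟨u, hsymm _ _ a5, by grind⟩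
      · exact ⟨v, hsymm _ _ a7, by grind⟩
      · exact ⟨u, hsymm _ _ a5, by grind⟩
    · exact ⟨x, a2, by grind⟩
    · exact ⟨s, hsymm _ _ a2, by grind⟩
  · intro r hr b hbr hcl
    obtain ⟨hcb, hcl⟩ := hcl
    have hclv := hcl v
    have hclu := hcl u
    have hcls := hcl s
    have hcl₁ := hcl t₁
    have hcl₂ := hcl t₂
    rcases hr with rfl | rfl | rfl | rfl | rfl | rfl
    · have : G.Adj s b := by grind
      rcases hcase with h | h | h <;> grind
    · rcases hcase with h | h | h
      · have := h₁₂ b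
        grind
      · have hb : G.Adj t₂ b := by grind
        have hbu : b ≠ u := by rintro rfl; grind
        have hcb' := hc b (by grind) (by grind) (by grind) (by grind) (by grind) (by grind)
        obtain ⟨z, hz⟩ := hleaf b hb hbu hbr
        obtain ⟨w, hw1, hw2⟩ := hgood.1 b z ((nbr_p₂ b z hb hbu hbr).2 ⟨hz.2, hz.1⟩)
        have hbw := (nbr_p₂ b w hb hbu hbr).1 hw1
        have hbR := hp₂ b hb hbu hbr
        have hwR := (hadj b w).1 hw1
        have := h₁₂ b
        have hcw : c w = c' w := hc w (by grind) (by grind) (by grind) (by grind)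
          (by grind) (by grind)
        have := (hcl w (by grind)).2 hbw.1
        grind
      · have hb : G.Adj t₁ b := by grind
        have hbu : b ≠ u := by rintro rfl; grind
        have hcb' := hc b (by grind) (by grind) (by grind) (by grind) (by grind) (by grind)
        have hβb := hβ b hb hbu hbr
        obtain ⟨w, hw1, hw2⟩ := hgood.1 b s ((nbr_p₁ b s hb hbu hbr).2 (Or.inl rfl))
        have hbw := (nbr_p₁ b w hb hbu hbr).1 hw1
        have hws : w ≠ s := by rintro rfl; grind
        have hbR := hp₁ b hb hbu hbr
        have hwR := (hadj b w).1 hw1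
        have := h₁₂ b
        have hcw : c w = c' w := hc w (by grind) (by grind) (by grind) (by grind)
          hws (by grind)
        have := (hcl w (by grind)).2 (by grind)
        grind
    · rcases hcase with h | h | h
      · have hbt : b = t₂ := by grind
        subst hbt
        have q1 : ∀ p, G.Adj r p → p = u ∨ p = v := by
          intro p hp
          by_contra hcon
          have hpR := hp₁ p hp (by grind) (by grind)
          have := serve₁ p hp (by grind) (by grind) (by grind)
          have := (hcl p (by grind)).1 hp
          have := h₁₂ p
          grind
        have q2 : ∀ p, G.Adj b p → p = u ∨ p = v := by
          intro p hp
          by_contra hcon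
          have hpR := hp₂ p hp (by grind) (by grind)
          have := serve₂ p hp (by grind) (by grind)
          have := (hcl p (by grind)).2 hp
          have := h₁₂ p
          grind
        exact Or.inl (by grind)
      · grind
      · grind
    · rcases hcase with h | h | h
      · have hbt : b = t₁ := by grind
        subst hbt
        have q1 : ∀ p, G.Adj b p → p = u ∨ p = v := by
          intro p hp
          by_contra hcon
          have hpR := hp₁ p hp (by grind) (by grind)
          have := serve₁ p hp (by grind) (by grind) (by grind)
          have := (hcl p (by grind)).2 hp
          have := h₁₂ p
          grind
        have q2 : ∀ p, G.Adj r p → p = u ∨ p = v := by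
          intro p hp
          by_contra hcon
          have hpR := hp₂ p hp (by grind) (by grind)
          have := serve₂ p hp (by grind) (by grind)
          have := (hcl p (by grind)).1 hp
          have := h₁₂ p
          grind
        exact Or.inl (by grind)
      · grind
      · grind
    · have := hcl x
      grind
    · have hb : G.Adj s b := by grind
      rcases (hs b).1 hb with h | h | h
      · subst h
        rcases hcase with h | h | h <;> grind
      · exact (hbr h).elim
      · subst h
        have := key (by grind) (by grind)
        exact Or.inl (by grind)

/-- Two vertices have at most two common neighbours. -/
def NoTriple (G : SimpleGraph V) : Prop :=
  ∀ t₁ t₂ a b d, t₁ ≠ t₂ → a ≠ b → a ≠ d → b ≠ d → G.Adj a t₁ → G.Adj b t₁ → G.Adj d t₁ →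
    G.Adj a t₂ → G.Adj b t₂ → G.Adj d t₂ → False

lemma SmallerGood.noTriple {G : SimpleGraph V} (hG : SmallerGood G) (h3 : AtMostThree G)
    (hcon : ¬ ∃ c, Good G c) : NoTriple G := by
  intro t₁ t₂ a b d ht hab had hbd h1 h2 h3' h4 h5 h6
  obtain ⟨c', hc'⟩ := hG (isolate G {t₂}) (isolate_atMostThree h3 _)
    (isolate_support_ssubset (x := t₂) (by simp) h4.symm)
  refine hcon (exists_good_of_openTwins h3 ht (fun w => ⟨fun h => ?_, fun h => ?_⟩) h1.symm h2.symm
    h3'.symm hab had hbd hc')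
  · rcases h3.nbr_eq h1.symm h2.symm h3'.symm hab had hbd h with rfl | rfl | rfl
    exacts [h4.symm, h5.symm, h6.symm]
  · rcases h3.nbr_eq h4.symm h5.symm h6.symm hab had hbd h with rfl | rfl | rfl
    exacts [h1.symm, h2.symm, h3'.symm]

/-- A four-cycle with a pendant path and a leaf can be removed if it forms a component. -/
lemma exists_good_of_component {G : SimpleGraph V} {c' : V → Bool} {u v t₁ t₂ s x : V}
    (hx : ∀ w, G.Adj x w ↔ w = s) (hs : ∀ w, G.Adj s w ↔ w = u ∨ w = x ∨ w = t₁)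
    (hu : ∀ w, G.Adj u w ↔ w = s ∨ w = t₁ ∨ w = t₂) (hv : ∀ w, G.Adj v w ↔ w = t₁ ∨ w = t₂)
    (h₁ : ∀ w, G.Adj t₁ w ↔ w = u ∨ w = v ∨ w = s) (h₂ : ∀ w, G.Adj t₂ w ↔ w = u ∨ w = v)
    (huv : u ≠ v) (htt : t₁ ≠ t₂) (hsv : s ≠ v) (hst₂ : s ≠ t₂)
    (hux : u ≠ x) (hvx : v ≠ x) (ht₁x : t₁ ≠ x) (ht₂x : t₂ ≠ x)
    (hgood : Good (isolate G {u, v, t₁, t₂, s, x}) c') : ∃ c, Good G c := by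
  classical
  have a1 : G.Adj s u := (hs u).2 (Or.inl rfl)
  have a2 : G.Adj s x := (hs x).2 (Or.inr (Or.inl rfl))
  have a3 : G.Adj s t₁ := (hs t₁).2 (Or.inr (Or.inr rfl))
  have a4 : G.Adj u t₁ := (hu t₁).2 (Or.inr (Or.inl rfl))
  have a5 : G.Adj u t₂ := (hu t₂).2 (Or.inr (Or.inr rfl))
  have a6 : G.Adj v t₁ := (hv t₁).2 (Or.inl rfl)
  have a7 : G.Adj v t₂ := (hv t₂).2 (Or.inr rfl)
  have hsu := a1.ne
  have hsx := a2.ne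
  have hst₁ := a3.ne
  have hut₁ := a4.ne
  have hut₂ := a5.ne
  have hvt₁ := a6.ne
  have hvt₂ := a7.ne
  have hsymm : ∀ a b, G.Adj a b → G.Adj b a := fun a b h => h.symm
  obtain ⟨c, hcs, hcx, hcu, hct₁, hcv, hct₂, hc⟩ : ∃ c : V → Bool, c s = true ∧ c x = false ∧
      c u = false ∧ c t₁ = true ∧ c v = true ∧ c t₂ = false ∧
      ∀ a, a ≠ u → a ≠ v → a ≠ t₁ → a ≠ t₂ → a ≠ s → a ≠ x → c a = c' a :=
    ⟨fun a => if a = s ∨ a = t₁ ∨ a = v then true else if a = x ∨ a = u ∨ a = t₂ then false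
      else c' a, by grind⟩
  have hR : ∀ a, a ∈ ({u, v, t₁, t₂, s, x} : Set V) ↔
      a = u ∨ a = v ∨ a = t₁ ∨ a = t₂ ∨ a = s ∨ a = x := by simp
  have hadj : ∀ a b, (isolate G {u, v, t₁, t₂, s, x}).Adj a b ↔ G.Adj a b ∧
      ¬ (a = u ∨ a = v ∨ a = t₁ ∨ a = t₂ ∨ a = s ∨ a = x) ∧
      ¬ (b = u ∨ b = v ∨ b = t₁ ∨ b = t₂ ∨ b = s ∨ b = x) := by
    intro a b
    rw [← hR a, ← hR b]
    rfl
  have hclosed : ∀ a w, G.Adj a w → (a = u ∨ a = v ∨ a = t₁ ∨ a = t₂ ∨ a = s ∨ a = x) →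
      (w = u ∨ w = v ∨ w = t₁ ∨ w = t₂ ∨ w = s ∨ w = x) := by
    rintro a w h (rfl | rfl | rfl | rfl | rfl | rfl) <;> grind
  have hnbr : ∀ a w, ¬ (a = u ∨ a = v ∨ a = t₁ ∨ a = t₂ ∨ a = s ∨ a = x) →
      ((isolate G {u, v, t₁, t₂, s, x}).Adj a w ↔ G.Adj a w) := by
    intro a w ha
    rw [hadj]
    exact ⟨fun h => h.1, fun h => ⟨h, ha, fun hw => ha (hclosed w a h.symm hw)⟩⟩
  refine ⟨c, good_of_extend {u, v, t₁, t₂, s, x} (c' := c')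
    (G' := isolate G {u, v, t₁, t₂, s, x}) ?_ hgood ?_ ?_ ?_ ?_ ?_ ?_ ?_⟩
  all_goals simp only [hR]
  · intro a b ha hb
    exact hnbr a b ha
  · grind
  · intro r hr a b ha hb hra hrb
    exact (ha (hclosed r a hra hr)).elim
  · intro w r hw hr hwr
    exact ((hadj w r).1 hwr).2.2.elim hr
  · intro w r hw hr hwr
    exact (hw (hclosed r w hwr.symm hr)).elim
  · intro a b ha hb hab hcab htw
    left
    simpa only [Twins, hnbr a _ ha, hnbr b _ hb] using htw
  · intro r hr w hw
    rcases hr with rfl | rfl | rfl | rfl | rfl | rfl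
    · exact ⟨s, by grind⟩
    · exact ⟨t₂, by grind⟩
    · exact ⟨u, by grind⟩
    · exact ⟨v, by grind⟩
    · exact ⟨x, by grind⟩
    · exact ⟨s, by grind⟩
  · intro r hr b hbr hcl
    exfalso
    obtain ⟨hcb, hcl⟩ := hcl
    have hclv := hcl v
    have hclu := hcl u
    have hcls := hcl s
    have hclx := hcl x
    have hcl₁ := hcl t₁
    have hcl₂ := hcl t₂
    rcases hr with rfl | rfl | rfl | rfl | rfl | rfl <;> grind

section
variable {G : SimpleGraph V} {c : V → Bool} {u v s t₁ t₂ x y : V}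

lemma SmallerGood.of_fourCycle_triangle (hG : SmallerGood G) (h3 : AtMostThree G)
    (hx : ∀ w, G.Adj x w ↔ w = s) (hs : ∀ w, G.Adj s w ↔ w = u ∨ w = x ∨ w = t₁)
    (hu : ∀ w, G.Adj u w ↔ w = s ∨ w = t₁ ∨ w = t₂) (hv : ∀ w, G.Adj v w ↔ w = t₁ ∨ w = t₂)
    (huv : u ≠ v) (htt : t₁ ≠ t₂) (hsv : s ≠ v) (hst₂ : s ≠ t₂) (hux : u ≠ x) (hvx : v ≠ x)
    (ht₁x : t₁ ≠ x) (ht₂x : t₂ ≠ x) : ∃ c, Good G c := by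
  have hsymm : ∀ a b, G.Adj a b → G.Adj b a := fun a b h => h.symm
  have hirr : ∀ a, ¬ G.Adj a a := fun a => G.loopless.irrefl a
  have hadj := @isolate_pair_adj V G
  have a1 : G.Adj s u := (hs u).2 (Or.inl rfl)
  have a2 : G.Adj s x := (hs x).2 (Or.inr (Or.inl rfl))
  have a3 : G.Adj s t₁ := (hs t₁).2 (Or.inr (Or.inr rfl))
  have a4 : G.Adj u t₁ := (hu t₁).2 (Or.inr (Or.inl rfl))
  have a5 : G.Adj u t₂ := (hu t₂).2 (Or.inr (Or.inr rfl))
  have a6 : G.Adj v t₁ := (hv t₁).2 (Or.inl rfl)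
  have a7 : G.Adj v t₂ := (hv t₂).2 (Or.inr rfl)
  have hsu := a1.ne
  have hst₁ := a3.ne
  have hvt₂ := a7.ne
  have hut₂ := a5.ne
  have h₁ : ∀ w, G.Adj t₁ w ↔ w = u ∨ w = v ∨ w = s := fun w =>
    ⟨fun h => h3.nbr_eq a4.symm a6.symm a3.symm huv hsu.symm hsv.symm h, by grind⟩
  by_cases h₂ : ∀ w, G.Adj t₂ w → w = u ∨ w = v
  · obtain ⟨c', hc'⟩ := hG (isolate G {u, v, t₁, t₂, s, x}) (isolate_atMostThree h3 _)
      (isolate_support_ssubset (x := s) (by simp) a1)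
    exact exists_good_of_component hx hs hu hv h₁ (by grind) huv htt hsv hst₂ hux hvx ht₁x ht₂x hc'
  · push Not at h₂
    obtain ⟨p, hp, hpu, hpv⟩ := h₂
    have hps : p ≠ s := by rintro rfl; grind
    have hpx : p ≠ x := by rintro rfl; grind
    refine hG.of_leaf h3 hx a1 hux fun w hw hwx hwu => ?_
    obtain rfl : w = t₁ := by grind
    refine ⟨⟨u, hsu.symm, a4.symm⟩, fun b hbw hbs hbx htw => ?_⟩
    exfalso
    simp only [Twins, hadj] at htw
    have := htw.imp (fun h => h u) (fun h => h u)
    have := htw.imp (fun h => h v) (fun h => h v)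
    have := htw.imp (fun h => h p) (fun h => h p)
    have := htw.imp (fun h => h t₂) (fun h => h t₂)
    have := h₁ p
    grind

lemma SmallerGood.of_fork_leaf (hG : SmallerGood G) (h3 : AtMostThree G) (hmc : MaxCut G c)
    (h : Fork G c u v t₁ t₂) (hus : G.Adj u s) (hcs : c s = c u) (hsv : s ≠ v)
    (hx : ∀ w, G.Adj x w ↔ w = s) : ∃ c, Good G c := by
  by_contra hcon
  have hT := hG.noTriple h3 hcon
  have hsymm : ∀ a b, G.Adj a b → G.Adj b a := fun a b h => h.symm
  have hirr : ∀ a, ¬ G.Adj a a := fun a => G.loopless.irrefl a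
  have hadj := @isolate_pair_adj V G
  have hc₁ := fun w hw => h.bichromatic h3 hmc hus hcs hsv (w := w) hw
  have hc₂ := fun w hw => h.swap.bichromatic h3 hmc hus hcs hsv (w := w) hw
  obtain ⟨huv, htt, hcuv, hct₁, hct₂, huN, hvN⟩ := h
  have hnus := hus.ne
  have a4 : G.Adj u t₁ := (huN t₁ hct₁).2 (Or.inl rfl)
  have a5 : G.Adj u t₂ := (huN t₂ hct₂).2 (Or.inr rfl)
  have a6 : G.Adj v t₁ := (hvN t₁ hct₁).2 (Or.inl rfl)
  have a7 : G.Adj v t₂ := (hvN t₂ hct₂).2 (Or.inr rfl)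
  have hst₁ : s ≠ t₁ := by rintro rfl; exact hct₁ hcs
  have hst₂ : s ≠ t₂ := by rintro rfl; exact hct₂ hcs
  have hu : ∀ w, G.Adj u w ↔ w = s ∨ w = t₁ ∨ w = t₂ := fun w =>
    ⟨fun h => h3.nbr_eq hus a4 a5 hst₁ hst₂ htt h, by grind⟩
  have hux : u ≠ x := by rintro rfl; grind
  have hvx : v ≠ x := by rintro rfl; grind
  have ht₁x : t₁ ≠ x := by rintro rfl; grind
  have ht₂x : t₂ ≠ x := by rintro rfl; grind
  have a2 : G.Adj s x := hsymm _ _ ((hx s).2 rfl)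
  have hsx := a2.ne
  have ht₁₂ : ¬ G.Adj t₁ t₂ := fun h => hc₁ _ h (by
    rw [Bool.eq_not_of_ne hct₁, Bool.eq_not_of_ne hct₂])
  obtain ⟨y, hsy, hcy, hyu, hyx⟩ := hmc.exists_third_of_leaf hx hus.symm hcs hux
  have hs : ∀ w, G.Adj s w ↔ w = u ∨ w = x ∨ w = y := fun w =>
    ⟨fun h => h3.nbr_eq hus.symm a2 hsy hux hyu.symm hyx.symm h, by grind⟩
  have hv : ∀ w, G.Adj v w ↔ w = t₁ ∨ w = t₂ := by
    by_contra hcon2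
    obtain ⟨p, hp, hp₁, hp₂⟩ : ∃ p, G.Adj v p ∧ p ≠ t₁ ∧ p ≠ t₂ := by
      by_contra! hcon3
      exact hcon2 (by grind)
    have hcp : c p = c v := by grind
    have hpu : p ≠ u := by rintro rfl; grind
    have hps : p ≠ s := by
      rintro rfl
      exact huv (hmc.partner_unique h3 (hsymm _ _ hus) (hsymm _ _ hp) hcs hcp)
    have hpx : p ≠ x := by rintro rfl; grind
    refine hcon (hG.of_leaf h3 hx hsy hyx fun w hw hwx hwy => ?_)
    obtain rfl : w = u := by grind
    refine ⟨⟨t₁, hst₁.symm, a4⟩, fun b hbu hbs hbx htw => ?_⟩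
    exfalso
    simp only [Twins, hadj] at htw
    have h1 := htw.imp (fun h => h t₁) (fun h => h t₁)
    have h2 := htw.imp (fun h => h t₂) (fun h => h t₂)
    have h4 := htw.imp (fun h => h v) (fun h => h v)
    have h5 := htw.imp (fun h => h p) (fun h => h p)
    have hT := hT t₁ t₂ w v b htt
    grind
  by_cases hyt₁ : y = t₁
  · subst hyt₁
    exact hcon (hG.of_fourCycle_triangle h3 hx hs hu hv huv htt hsv hst₂ hux hvx ht₁x ht₂x)
  by_cases hyt₂ : y = t₂
  · subst hyt₂
    exact hcon (hG.of_fourCycle_triangle h3 hx hs (by grind) (by grind) huv htt.symm hsv hst₁ hux hvx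
      ht₂x ht₁x)
  have hcyt : ∀ t, c t ≠ c u → c y = c t := by
    intro t ht
    rw [Bool.eq_not_of_ne hcy, Bool.eq_not_of_ne ht, hcs]
  have hy₁ : ¬ G.Adj y t₁ := fun h => hc₁ y h.symm (hcyt _ hct₁)
  have hy₂ : ¬ G.Adj y t₂ := fun h => hc₂ y h.symm (hcyt _ hct₂)
  have hs₁ : ¬ G.Adj s t₁ := by grind
  have hs₂ : ¬ G.Adj s t₂ := by grind
  have third : ∀ t, G.Adj u t → G.Adj v t → ∀ p q, G.Adj t p → G.Adj t q → p ≠ u → p ≠ v →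
      q ≠ u → q ≠ v → p = q := by
    intro t hut hvt p q hp hq hpu hpv hqu hqv
    have := h3.nbr_eq hut.symm hvt.symm hp huv hpu.symm hpv.symm hq
    grind
  have hleaf : ∀ p, G.Adj t₂ p → p ≠ u → p ≠ v → ∃ z, z ≠ t₂ ∧ G.Adj p z := by
    intro p hp hpu hpv
    by_contra! hp2
    refine hcon (hG.of_leaf h3 (x := p) (s := t₂) (y := v) (fun w => ⟨fun h => ?_, ?_⟩)
      (hsymm _ _ a7) hpv.symm fun w hw hwp hwv => ?_)
    · by_contra hw
      exact hp2 w hw h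
    · rintro rfl
      exact hp.symm
    obtain rfl : w = u := by
      have := h3.nbr_eq (hsymm _ _ a5) (hsymm _ _ a7) hp huv hpu.symm hpv.symm hw
      grind
    have hps : p ≠ s := by rintro rfl; grind
    have hpt₁ : p ≠ t₁ := by rintro rfl; grind
    refine ⟨⟨s, hst₂, hus⟩, fun b hbu hbt hbp htw => ?_⟩
    exfalso
    simp only [Twins, hadj] at htw
    have h1 := htw.imp (fun h => h t₁) (fun h => h t₁)
    have h2 := htw.imp (fun h => h s) (fun h => h s)
    have h4 := htw.imp (fun h => h v) (fun h => h v)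
    have h5 := htw.imp (fun h => h x) (fun h => h x)
    grind
  have h₁₂ : ∀ p, G.Adj t₁ p → G.Adj t₂ p → p = u ∨ p = v := by
    intro p hp1 hp2
    have hT := hT t₁ t₂ u v p htt huv
    grind
  let G' : SimpleGraph V := isolate G {u, v, t₁, t₂} ⊔
    fromRel fun a b => a = s ∧ G.Adj t₁ b ∧ b ≠ u ∧ b ≠ v
  have hadj' : ∀ a b, G'.Adj a b ↔
      (G.Adj a b ∧ a ≠ u ∧ a ≠ v ∧ a ≠ t₁ ∧ a ≠ t₂ ∧ b ≠ u ∧ b ≠ v ∧ b ≠ t₁ ∧ b ≠ t₂) ∨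
      (a = s ∧ G.Adj t₁ b ∧ b ≠ u ∧ b ≠ v) ∨ (b = s ∧ G.Adj t₁ a ∧ a ≠ u ∧ a ≠ v) := by
    intro a b
    simp only [G', sup_adj, fromRel_adj, isolate, Set.mem_insert_iff, Set.mem_singleton_iff]
    grind
  clear_value G'
  have hsupp : G'.support ⊂ G.support := by
    refine ⟨fun a ha => ?_, fun hsub => ?_⟩
    · obtain ⟨b, hb⟩ := (mem_support _).1 ha
      rcases (hadj' a b).1 hb with h | ⟨rfl, -⟩ | h
      · exact (mem_support _).2 ⟨b, h.1⟩
      · exact (mem_support _).2 ⟨x, a2⟩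
      · exact (mem_support _).2 ⟨t₁, hsymm _ _ h.2.1⟩
    · obtain ⟨b, hb⟩ := (mem_support _).1 (hsub ((mem_support G).2 ⟨t₁, a6⟩))
      have := (hadj' v b).1 hb
      grind
  have h3' : AtMostThree G' := by
    intro a
    by_cases has : a = s
    · subst has
      by_cases hp : ∃ p, G.Adj t₁ p ∧ p ≠ u ∧ p ≠ v
      · obtain ⟨p, hp⟩ := hp
        refine ⟨x, y, p, fun w hw => ?_⟩
        have := third t₁ a4 a6 p w
        have := (hadj' a w).1 hw
        grind
      · refine ⟨x, y, y, fun w hw => ?_⟩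
        have := (hadj' a w).1 hw
        grind
    obtain ⟨p, q, r, hpqr⟩ := h3 a
    by_cases hat : G.Adj t₁ a
    · have hs' : ∀ w, G'.Adj a w → w = s ∨ (G.Adj a w ∧ w ≠ t₁) := by
        intro w hw
        have := (hadj' a w).1 hw
        grind
      rcases hpqr t₁ hat.symm with h | h | h
      · exact ⟨s, q, r, by grind⟩
      · exact ⟨p, s, r, by grind⟩
      · exact ⟨p, q, s, by grind⟩
    · refine ⟨p, q, r, fun w hw => hpqr w ?_⟩
      have := (hadj' a w).1 hw
      grind
  obtain ⟨c', hc'⟩ := hG G' h3' hsupp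
  exact hcon (exists_good_of_fourCycle hx hs hu hv (third t₁ a4 a6) (third t₂ a5 a7) h₁₂ hleaf hs₁ hs₂
    hy₁ hy₂ ht₁₂ htt huv hsv hux hyu.symm hyx.symm hadj' hc')

end

/-- `u` and `v` clash without being twins. -/
def BadPair (G : SimpleGraph V) (c : V → Bool) (u v : V) : Prop :=
  u ≠ v ∧ Clash G c u v ∧ ¬ Twins G u v

/-- `u` has a neighbour of its own colour. -/
def HasPartner (G : SimpleGraph V) (c : V → Bool) (u : V) : Prop :=
  ∃ w, G.Adj u w ∧ c w = c u

/-- Each vertex of `U` belongs to a fork whose other vertices stay outside `U`. -/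
def Switchable (G : SimpleGraph V) (c : V → Bool) (U : Set V) : Prop :=
  ∀ r ∈ U, ∀ t, G.Adj r t → c t ≠ c r → ∃ r' v t', Fork G c r v t t' ∧ G.Adj r r' ∧
    c r' = c r ∧ r' ≠ v ∧ r' ∉ U ∧ v ∉ U ∧ t ∉ U ∧ ∀ w, G.Adj t w → c w ≠ c t

section
variable {G : SimpleGraph V} {c : V → Bool} {u v r t a b : V} {U : Set V}

lemma BadPair.symm (h : BadPair G c u v) : BadPair G c v u :=
  ⟨h.1.symm, h.2.1.symm, fun ht => h.2.2 ht.symm⟩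

lemma SmallerGood.fork_of_badPair (hG : SmallerGood G) (h3 : AtMostThree G) (hmc : MaxCut G c)
    (hcon : ¬ ∃ c, Good G c) (h : BadPair G c u v) (hp : HasPartner G c u) :
    ∃ t₁ t₂, Fork G c u v t₁ t₂ := by
  obtain ⟨s, hs, hcs⟩ := hp
  rcases h.2.1.cases h3 hmc h.1 h.2.2 hs hcs with ⟨t, hct, hu, hv⟩ | h'
  · exact absurd (hG.of_leaf_clash h3 hmc h.1.symm hv hu hcs hct h.2.1.1.symm) hcon
  · exact h'

lemma HasPartner.of_badPair (h : BadPair G c u v) : HasPartner G c u ∨ HasPartner G c v := by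
  by_contra! hn
  obtain ⟨-, ⟨hc, hw⟩, hnt⟩ := h
  simp only [HasPartner, not_exists, not_and] at hn
  refine hnt (Or.inl fun w => ⟨fun h => (hw w (hn.1 w h)).1 h, fun h => (hw w ?_).2 h⟩)
  rw [hc]
  exact hn.2 w h

lemma SmallerGood.switchable (hG : SmallerGood G) (h3 : AtMostThree G) (hmc : MaxCut G c)
    (hcon : ¬ ∃ c, Good G c)
    (hU : ∀ u ∈ U, HasPartner G c u ∧ ∃ v, BadPair G c u v)
    (hind : ∀ a ∈ U, ∀ b ∈ U, ¬ (G.Adj a b ∧ c b = c a) ∧ ¬ BadPair G c a b) :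
    Switchable G c U := by
  intro r hr t ht hct
  obtain ⟨hp, v, hv⟩ := hU r hr
  obtain ⟨t', hf⟩ : ∃ t', Fork G c r v t t' := by
    obtain ⟨t₁, t₂, hf⟩ := hG.fork_of_badPair h3 hmc hcon hv hp
    rcases (hf.nbr t hct).1 ht with rfl | rfl
    exacts [⟨_, hf⟩, ⟨_, hf.swap⟩]
  obtain ⟨r', hr', hcr'⟩ := hp
  have hne : r' ≠ v := by
    rintro rfl
    refine hv.2.2 (Or.inr fun w => ?_)
    have h1 := hv.2.1.2 w
    have h2 := hmc.partner_unique h3 (v := r) (a := r') (b := w) hr'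
    have h3 := hmc.partner_unique h3 (v := r') (a := r) (b := w) hr'.symm
    have := hr'.symm
    grind
  have hb := fun w hw => hf.bichromatic h3 hmc hr' hcr' hne (w := w) hw
  refine ⟨r', v, t', hf, hr', hcr', hne, fun h => (hind r hr r' h).1 ⟨hr', hcr'⟩,
    fun h => (hind r hr v h).2 hv, fun h => ?_, hb⟩
  obtain ⟨⟨w, hw, hcw⟩, -⟩ := hU t h
  exact hb w hw hcw

lemma Switchable.eq_of_adj (hS : Switchable G c U) (h3 : AtMostThree G) (hT : NoTriple G)
    (hr : r ∈ U) (ha : a ∈ U) (hrt : G.Adj r t) (hct : c t ≠ c r) (hat : G.Adj a t) : a = r := by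
  by_contra hne
  obtain ⟨r', v, t', hf, -, -, -, -, hvU, -, hb⟩ := hS r hr t hrt hct
  have hca := hb a hat.symm
  obtain ⟨a', v', s', hf', -, -, -, -, hvU', -, -⟩ := hS a ha t hat hca.symm
  have hvt : G.Adj v t := (hf.nbr' t hct).2 (Or.inl rfl)
  have hvt' : G.Adj v' t := (hf'.nbr' t hca.symm).2 (Or.inl rfl)
  have hav : a ≠ v := by rintro rfl; exact hvU ha
  obtain rfl : v' = v := by
    have := h3.nbr_eq hrt.symm hvt.symm hat.symm hf.ne (Ne.symm hne) hav.symm hvt'.symm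
    have := hf'.ne
    grind
  have hc : c a = c r := by rw [hf'.color, hf.color]
  have ha' : G.Adj a t' := by
    have := (hf'.nbr' t' (by have := hf.color₂; grind)).1
      ((hf.nbr' t' hf.color₂).2 (Or.inr rfl))
    exact (hf'.nbr t' (by have := hf.color₂; grind)).2 this
  exact hT t t' r v' a hf.ne' hf.ne (Ne.symm hne) hav.symm hrt hvt hat
    ((hf.nbr t' hf.color₂).2 (Or.inr rfl)) ((hf.nbr' t' hf.color₂).2 (Or.inr rfl)) ha'

open Classical in
/-- The colouring `c` with the colours of the vertices of `U` switched. -/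
noncomputable def switch (c : V → Bool) (U : Set V) (v : V) : Bool :=
  if v ∈ U then !c v else c v

lemma switch_of_mem (h : v ∈ U) : switch c U v = !c v := if_pos h

lemma switch_of_notMem (h : v ∉ U) : switch c U v = c v := if_neg h

lemma Switchable.not_clash_of_mem_of_notMem (hS : Switchable G c U) (hG : SmallerGood G)
    (h3 : AtMostThree G) (hmc : MaxCut G c) (hT : NoTriple G) (hcon : ¬ ∃ c, Good G c)
    (ha : a ∈ U) (hb : b ∉ U) (hP : HasPartner G c a) (h : Clash G (switch c U) a b) : False := by
  have hsymm : ∀ a b, G.Adj a b → G.Adj b a := fun a b h => h.symm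
  obtain ⟨hc, hw⟩ := h
  have hca := switch_of_mem (c := c) ha
  have hcb := switch_of_notMem (c := c) hb
  obtain ⟨t, hat, hct⟩ : ∃ t, G.Adj a t ∧ c t ≠ c a := hmc.exists_cut hP.choose_spec.1
  obtain ⟨a', v, t', hf, haa', hca', hav, ha'U, hvU, htU, hbi⟩ := hS a ha t hat hct
  have hcc : c b ≠ c a := by
    rw [← hcb, ← hc, hca]; simp
  have hba' : G.Adj b a' := by
    refine (hw a' ?_).1 haa'
    rw [switch_of_notMem ha'U, hca, hca']; simp
  have hother : ∀ w, G.Adj b w → w ≠ a' → w ∉ U ∧ c w = c b := by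
    intro w hbw hwa'
    have hsw : switch c U w = c b := by
      by_contra hne
      have hne' : switch c U w ≠ switch c U a := by rw [hc, hcb]; exact hne
      have haw := (hw w hne').2 hbw
      by_cases hwU : w ∈ U
      · have hcw : c w ≠ c a := by
          have := switch_of_mem (c := c) hwU
          rw [Bool.eq_not_of_ne hne, Bool.eq_not_of_ne hcc, Bool.not_not] at this
          simp [this]
        obtain ⟨-, -, -, -, -, -, -, -, -, h, -⟩ := hS a ha w haw hcw
        exact h hwU
      · rw [switch_of_notMem hwU, Bool.eq_not_of_ne hcc] at hne
        have hcw := Bool.eq_not_of_ne hne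
        rw [Bool.not_not] at hcw
        exact hwa' (hmc.partner_unique h3 haw haa' hcw.symm hca'.symm)
    have hwU : w ∉ U := by
      intro hwU
      have hcw : c b ≠ c w := by
        rw [← hsw, switch_of_mem hwU]; simp
      obtain ⟨w', v', s, hf', hww', hcw', hwv', hw'U, hv'U, -, hbi'⟩ :=
        hS w hwU b (hsymm _ _ hbw) hcw
      have hbv' : G.Adj b v' := hsymm _ _ ((hf'.nbr' b hcw).2 (Or.inl rfl))
      have hcv' := hbi' v' hbv'
      have hev : ∀ q, G.Adj b q → q ∉ U → q = a' := by
        intro q hbq hqU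
        have hcq := hbi' q hbq
        have haq := (hw q (by rw [switch_of_notMem hqU, hc, hcb]; exact hcq)).2 hbq
        refine hmc.partner_unique h3 haq haa' ?_ hca'.symm
        rw [Bool.eq_not_of_ne hcq, Bool.eq_not_of_ne hcc, Bool.not_not]
      have hv'a := hev v' hbv' hv'U
      rw [hv'a] at hf' hwv'
      obtain ⟨q, hbq, hqw, hqa⟩ := hf'.exists_third h3 hmc hww' hcw' hwv' haa'.symm hca'.symm
      by_cases hqU : q ∈ U
      · exact hqw (hS.eq_of_adj h3 hT hwU hqU (hsymm _ _ hbw) hcw hbq.symm)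
      · exact hqa (hev q hbq hqU)
    exact ⟨hwU, by rw [← hsw, switch_of_notMem hwU]⟩
  by_cases hp : ∃ p, G.Adj b p ∧ p ≠ a'
  · obtain ⟨p, hbp, hpa'⟩ := hp
    have hcp := (hother p hbp hpa').2
    have hbN : ∀ w, G.Adj b w → w = a' ∨ w = p := by
      intro w hbw
      by_cases hwa : w = a'
      · exact Or.inl hwa
      · exact Or.inr (hmc.partner_unique h3 hbw hbp (hother w hbw hwa).2.symm hcp.symm)
    have hab : a ≠ b := by rintro rfl; exact hb ha
    obtain ⟨d, hd⟩ := h3.exists_third haa'.symm (hsymm _ _ hba') hab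
    have hne₁ := haa'.ne
    have hne₂ := hba'.ne
    have hne₃ := hbp.ne
    have hap : a ≠ p := by rintro rfl; exact hcc hcp.symm
    obtain ⟨x, y, hx, hy, hxy, hcxy, hne⟩ := hmc.two (fun w => w = b ∨ w = a')
      (p := b) (q := p) (p' := a') (q' := a)
      (by grind) (by grind) hbp hcp.symm (by grind) (by grind) haa'.symm hca' (by grind) a' d
    have := hbN y
    have := hd y
    grind
  · push Not at hp
    exact hcon (hG.of_fork_leaf h3 hmc hf haa' hca' hav
      fun w => ⟨hp w, by rintro rfl; exact hba'⟩)

lemma Switchable.not_clash_of_notMem (hS : Switchable G c U) (h3 : AtMostThree G)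
    (hmc : MaxCut G c) (hT : NoTriple G) (ha : a ∉ U) (hb : b ∉ U) (hab : a ≠ b)
    (h : Clash G (switch c U) a b) (hnt : ¬ Twins G a b) (hr : r ∈ U) (har : G.Adj a r) :
    False := by
  have hsymm : ∀ a b, G.Adj a b → G.Adj b a := fun a b h => h.symm
  obtain ⟨hc, hw⟩ := h
  rw [switch_of_notMem ha, switch_of_notMem hb] at hc
  rw [switch_of_notMem ha] at hw
  have hw' : ∀ w ∉ U, c w ≠ c a → (G.Adj a w ↔ G.Adj b w) := fun w hwU hcw =>
    hw w (by rwa [switch_of_notMem hwU])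
  by_cases hcr : c a = c r
  · have hbr : G.Adj b r := (hw r (by rw [switch_of_mem hr, hcr]; simp)).1 har
    exact hab (hmc.partner_unique h3 har.symm hbr.symm hcr.symm (hcr.symm.trans hc))
  obtain ⟨r', v, t', hf, hrr', hcr', hav, hr'U, hvU, htU, hbi⟩ := hS r hr a har.symm hcr
  have hva : G.Adj v a := (hf.nbr' a hcr).2 (Or.inl rfl)
  have hvb : G.Adj v b := hsymm _ _ ((hw' v hvU (hbi v hva.symm)).1 hva.symm)
  have hcrb : c b ≠ c r := hc ▸ hcr
  obtain rfl : b = t' := ((hf.nbr' b hcrb).1 hvb).resolve_left hab.symm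
  have hrb : G.Adj r b := (hf.nbr b hcrb).2 (Or.inr rfl)
  have hbi' := fun w hw => hf.swap.bichromatic h3 hmc hrr' hcr' hav (w := w) hw
  refine hnt (Or.inl fun w => ?_)
  by_cases hwU : w ∈ U
  · constructor
    · intro haw
      rw [hS.eq_of_adj h3 hT hr hwU har.symm hcr haw.symm]
      exact hrb.symm
    · intro hbw
      rw [hS.eq_of_adj h3 hT hr hwU hrb hcrb hbw.symm]
      exact har
  · exact ⟨fun haw => (hw' w hwU (hbi w haw)).1 haw,
      fun hbw => (hw' w hwU (by rw [hc]; exact hbi' w hbw)).2 hbw⟩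

lemma SmallerGood.exists_mem_adj (hG : SmallerGood G) (h3 : AtMostThree G) (hmc : MaxCut G c)
    (hT : NoTriple G) (hcon : ¬ ∃ c, Good G c)
    (hmax : ∀ u ∉ U, HasPartner G c u → (∃ v, BadPair G c u v) →
      ∃ w ∈ U, G.Adj u w ∨ BadPair G c u w)
    (ha : a ∉ U) (hb : b ∉ U) (h : BadPair G c a b) (hp : HasPartner G c a) :
    ∃ r ∈ U, G.Adj a r := by
  obtain ⟨r, hr, har | har⟩ := hmax a ha hp ⟨b, h⟩
  · exact ⟨r, hr, har⟩
  exfalso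
  obtain ⟨t₁, t₂, hf⟩ := hG.fork_of_badPair h3 hmc hcon h hp
  have hr₁ := (har.2.1.2 t₁ hf.color₁).1 ((hf.nbr t₁ hf.color₁).2 (Or.inl rfl))
  have hr₂ := (har.2.1.2 t₂ hf.color₂).1 ((hf.nbr t₂ hf.color₂).2 (Or.inr rfl))
  exact hT t₁ t₂ a b r hf.ne' h.1 har.1 (by rintro rfl; exact hb hr)
    ((hf.nbr t₁ hf.color₁).2 (Or.inl rfl)) ((hf.nbr' t₁ hf.color₁).2 (Or.inl rfl)) hr₁
    ((hf.nbr t₂ hf.color₂).2 (Or.inr rfl)) ((hf.nbr' t₂ hf.color₂).2 (Or.inr rfl)) hr₂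

lemma SmallerGood.good_switch (hG : SmallerGood G) (h3 : AtMostThree G) (hmc : MaxCut G c)
    (hcon : ¬ ∃ c, Good G c) (hU : ∀ u ∈ U, HasPartner G c u ∧ ∃ v, BadPair G c u v)
    (hind : ∀ a ∈ U, ∀ b ∈ U, ¬ (G.Adj a b ∧ c b = c a) ∧ ¬ BadPair G c a b)
    (hmax : ∀ u ∉ U, HasPartner G c u → (∃ v, BadPair G c u v) →
      ∃ w ∈ U, G.Adj u w ∨ BadPair G c u w) : Good G (switch c U) := by
  have hS := hG.switchable h3 hmc hcon hU hind
  have hT := hG.noTriple h3 hcon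
  refine ⟨fun v w hvw => ?_, fun a b hab h => ?_⟩
  · by_cases hv : v ∈ U
    · obtain ⟨⟨z, hz, hcz⟩, -⟩ := hU v hv
      refine ⟨z, hz, ?_⟩
      rw [switch_of_mem hv, switch_of_notMem fun h => (hind v hv z h).1 ⟨hz, hcz⟩, hcz]
      simp
    · obtain ⟨z, hz, hcz⟩ := hmc.exists_cut hvw
      by_cases hzU : z ∈ U
      · obtain ⟨r', v', t', hf, -, -, -, -, hv'U, -, hbi⟩ := hS z hzU v hz.symm hcz.symm
        have hvv' : G.Adj v v' := ((hf.nbr' v hcz.symm).2 (Or.inl rfl)).symm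
        refine ⟨v', hvv', ?_⟩
        rw [switch_of_notMem hv, switch_of_notMem hv'U]
        exact hbi v' hvv'
      · refine ⟨z, hz, ?_⟩
        rwa [switch_of_notMem hv, switch_of_notMem hzU]
  · by_contra hnt
    by_cases ha : a ∈ U <;> by_cases hb : b ∈ U
    · obtain ⟨⟨z, hz, hcz⟩, -⟩ := hU a ha
      have hc := h.1
      rw [switch_of_mem ha, switch_of_mem hb, Bool.not_inj_iff] at hc
      have hbz : G.Adj b z := by
        refine (h.2 z ?_).1 hz
        rw [switch_of_mem ha, switch_of_notMem fun h => (hind a ha z h).1 ⟨hz, hcz⟩, hcz]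
        simp
      exact hab (hmc.partner_unique h3 hz.symm hbz.symm hcz (hcz.trans hc))
    · exact hS.not_clash_of_mem_of_notMem hG h3 hmc hT hcon ha hb (hU a ha).1 h
    · exact hS.not_clash_of_mem_of_notMem hG h3 hmc hT hcon hb ha (hU b hb).1 h.symm
    · have h₁ : ∀ r ∈ U, ¬ G.Adj a r := fun r hr har =>
        hS.not_clash_of_notMem h3 hmc hT ha hb hab h hnt hr har
      have h₂ : ∀ r ∈ U, ¬ G.Adj b r := fun r hr hbr =>
        hS.not_clash_of_notMem h3 hmc hT hb ha hab.symm h.symm (fun h => hnt h.symm) hr hbr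
      have hbad : BadPair G c a b := by
        refine ⟨hab, ⟨?_, fun w hw => ?_⟩, hnt⟩
        · have := h.1
          rwa [switch_of_notMem ha, switch_of_notMem hb] at this
        · by_cases hwU : w ∈ U
          · exact iff_of_false (h₁ w hwU) (h₂ w hwU)
          · refine h.2 w ?_
            rwa [switch_of_notMem ha, switch_of_notMem hwU]
      rcases HasPartner.of_badPair hbad with hp | hp
      · obtain ⟨r, hr, har⟩ := hG.exists_mem_adj h3 hmc hT hcon hmax ha hb hbad hp
        exact h₁ r hr har
      · obtain ⟨r, hr, hbr⟩ := hG.exists_mem_adj h3 hmc hT hcon hmax hb ha hbad.symm hp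
        exact h₂ r hr hbr

lemma SmallerGood.exists_good [Finite V] (hG : SmallerGood G) (h3 : AtMostThree G) :
    ∃ c, Good G c := by
  by_contra hcon
  obtain ⟨c, hmc⟩ := exists_maxCut G
  let I : Set (Set V) := {U | (∀ u ∈ U, HasPartner G c u ∧ ∃ v, BadPair G c u v) ∧
    ∀ a ∈ U, ∀ b ∈ U, ¬ (G.Adj a b ∧ c b = c a) ∧ ¬ BadPair G c a b}
  obtain ⟨U, hU⟩ := (Set.toFinite I).exists_maximal ⟨∅, by simp [I]⟩
  obtain ⟨hU₁, hU₂⟩ := hU.prop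
  refine hcon ⟨_, hG.good_switch h3 hmc hcon hU₁ hU₂ fun u hu hp hbad => ?_⟩
  by_contra! hno
  refine hu (hU.le_of_ge (y := insert u U) ⟨?_, ?_⟩ (Set.subset_insert u U)
    (Set.mem_insert u U))
  · rintro x (rfl | hx)
    exacts [⟨hp, hbad⟩, hU₁ x hx]
  · rintro x (rfl | hx) y (rfl | hy)
    · exact ⟨fun h => G.loopless.irrefl _ h.1, fun h => h.1 rfl⟩
    · exact ⟨fun h => (hno y hy).1 h.1, (hno y hy).2⟩
    · exact ⟨fun h => (hno x hx).1 h.1.symm, fun h => (hno x hx).2 h.symm⟩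
    · exact hU₂ x hx y hy

end

lemma AtMostThree.exists_good [Finite V] {G : SimpleGraph V} (h3 : AtMostThree G) :
    ∃ c, Good G c := by
  induction hs : G.support using WellFoundedLT.induction generalizing G with
  | ind s ih =>
    subst hs
    exact SmallerGood.exists_good (fun G' h3' hlt => ih _ hlt h3' rfl) h3

lemma Subcubic.atMostThree [Finite V] {G : SimpleGraph V} (h : Subcubic G) : AtMostThree G := by
  intro v
  by_contra! hcon
  obtain ⟨a, ha, -⟩ := hcon v v v
  obtain ⟨b, hb, hba, -⟩ := hcon a a a
  obtain ⟨d, hd, hda, hdb, -⟩ := hcon a b b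
  obtain ⟨e, he, hea, heb, hed⟩ := hcon a b d
  have hsub : ({a, b, d, e} : Set V) ⊆ G.neighborSet v := by
    rintro x (rfl | rfl | rfl | rfl) <;> assumption
  have hcard := Set.ncard_le_ncard hsub (Set.toFinite _)
  rw [Set.ncard_insert_of_notMem (by simp; grind), Set.ncard_insert_of_notMem (by simp; grind),
    Set.ncard_pair hed.symm] at hcard
  have := h v
  unfold deg at this
  omega

lemma Twins.false_of_twinFree {G : SimpleGraph V} {u v : V} (h : Twins G u v) (huv : u ≠ v)
    (htf : TwinFree G) : False := by
  rcases h with h | h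
  · exact htf.1 ⟨u, v, huv, Set.ext h⟩
  · exact htf.2 ⟨u, v, huv, Set.ext h⟩

lemma Good.isLDSet {G : SimpleGraph V} {c : V → Bool} (h : Good G c) (htf : TwinFree G)
    (hiso : ∀ v, ∃ w, G.Adj v w) (i : Bool) : IsLDSet G {v | c v = i} := by
  refine ⟨fun v => ?_, fun u hu v hv huv heq => ?_⟩
  · by_cases hv : c v = i
    · exact ⟨v, Set.mem_insert _ _, hv⟩
    · obtain ⟨w, hw⟩ := hiso v
      obtain ⟨z, hz, hcz⟩ := h.1 v w hw
      refine ⟨z, Set.mem_insert_of_mem _ hz, ?_⟩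
      rw [Set.mem_ofPred_eq, Bool.eq_not_of_ne hcz, Bool.eq_not_of_ne hv, Bool.not_not]
  · rw [Set.mem_ofPred_eq] at hu hv
    refine (h.2 u v huv ⟨?_, fun w hw => ?_⟩).false_of_twinFree huv htf
    · rw [Bool.eq_not_of_ne hu, Bool.eq_not_of_ne hv]
    · have hcw : c w = i := by
        rw [Bool.eq_not_of_ne hw, Bool.eq_not_of_ne hu, Bool.not_not]
      have hwu : w ≠ u := by rintro rfl; exact hu hcw
      have hwv : w ≠ v := by rintro rfl; exact hv hcw
      simpa [closedNbhd, hcw, hwu, hwv] using Set.ext_iff.1 heq w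

end

/-- Every twin-free subcubic graph `G` on `n` vertices without isolated
vertices satisfies `γ^LD(G) ≤ n/2`. -/
theorem stmt0 {V : Type*} [Fintype V] (G : SimpleGraph V)
    (htf : TwinFree G) (hsub : Subcubic G)
    (hiso : ∀ v : V, deg G v ≠ 0) :
    2 * ldNum G ≤ Fintype.card V := by
  obtain ⟨c, hc⟩ := hsub.atMostThree.exists_good
  have hnbr : ∀ v, ∃ w, G.Adj v w := fun v => by
    by_contra! hcon
    refine hiso v ?_
    rw [deg, Set.ncard_eq_zero]
    exact Set.eq_empty_of_forall_notMem hcon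
  have hle : ∀ i, ldNum G ≤ {v | c v = i}.ncard := fun i =>
    Nat.sInf_le ⟨_, hc.isLDSet htf hnbr i, rfl⟩
  have hcard := Set.ncard_add_ncard_compl {v | c v = true}
  have hcompl : {v | c v = true}ᶜ = {v | c v = false} := by
    ext v
    simp
  rw [hcompl, Nat.card_eq_fintype_card] at hcard
  have h₁ := hle true
  have h₂ := hle false
  omega
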